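/- arXiv:2312.10497 — 2 statements merged into one kernel-verified Lean document; each statement's English description precedes it below -/
import Mathlib

section
/- Let μ₁ ≥ μ_M > 0 be reals, let B ∈ [0,∞] be a barrier, let b = (b₁, b₂) ∈ ℝ², and let z = (z₁, z₂) : [0,∞) → ℝ² be cadlag. Then there exists a unique cadlag function w = (w₁, w₂) : [0,∞) → ℝ² such that for all t ≥ 0: w₁(t) = b₁ + z₁(t) − ∫₀ᵗ (μ_M·φ₀(w₁)(s) − μ₁·φ_B(w₂)(s)) ds and w₂(t) = b₂ + z₂(t) + ψ₀(w₁)(t) − ∫₀ᵗ μ₁·φ_B(w₂)(s) ds. Moreover, if z is continuous then w is continuous. -/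
open MeasureTheory

/-- A function on `[0,∞)` (encoded as a function on `ℝ`) is cadlag: right
continuous at every `t ≥ 0` and possessing left limits at every `t > 0`. -/
def CadlagOn {E : Type*} [TopologicalSpace E] (f : ℝ → E) : Prop :=
  (∀ t : ℝ, 0 ≤ t → ContinuousWithinAt f (Set.Ici t) t) ∧
  (∀ t : ℝ, 0 < t → ∃ l : E, Filter.Tendsto f (nhdsWithin t (Set.Iio t)) (nhds l))

/-- One-sided reflection map with (finite) upper barrier `κ`: regulator part. -/
noncomputable def psiRefl (κ : ℝ) (x : ℝ → ℝ) (t : ℝ) : ℝ :=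
  sSup ((fun u => max (x u - κ) 0) '' Set.Icc (0:ℝ) t)

/-- One-sided reflection map with (finite) upper barrier `κ`: reflected part. -/
noncomputable def phiRefl (κ : ℝ) (x : ℝ → ℝ) (t : ℝ) : ℝ :=
  x t - psiRefl κ x t

/-- Regulator part of the reflection map with barrier `B ∈ [0,∞]`; for `B = ∞`
one sets `ψ_∞(x) = 0`. -/
noncomputable def psiBar (B : ENNReal) (x : ℝ → ℝ) (t : ℝ) : ℝ :=
  if B = ⊤ then 0 else psiRefl B.toReal x t

/-- Reflected part of the reflection map with barrier `B ∈ [0,∞]`; for `B = ∞`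
one sets `φ_∞(x) = x`. -/
noncomputable def phiBar (B : ENNReal) (x : ℝ → ℝ) (t : ℝ) : ℝ :=
  x t - psiBar B x t

/-- `(w₁, w₂)` solves the internally reflected integral equations
(equations (59)-(60) of the paper). -/
def IsTruncSol (μ₁ μM : ℝ) (B : ENNReal) (b₁ b₂ : ℝ) (z₁ z₂ w₁ w₂ : ℝ → ℝ) : Prop :=
  CadlagOn (fun t => (w₁ t, w₂ t)) ∧
  (∀ t, 0 ≤ t →
    w₁ t = b₁ + z₁ t - ∫ s in (0:ℝ)..t, (μM * phiRefl 0 w₁ s - μ₁ * phiBar B w₂ s)) ∧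
  (∀ t, 0 ≤ t →
    w₂ t = b₂ + z₂ t + psiRefl 0 w₁ t - ∫ s in (0:ℝ)..t, μ₁ * phiBar B w₂ s)

open Filter Set Topology

lemma CadlagOn.cfst {f g : ℝ → ℝ} (h : CadlagOn (fun t => (f t, g t))) : CadlagOn f :=
  ⟨fun t ht => (h.1 t ht).fst, fun t ht => by
    obtain ⟨l, hl⟩ := h.2 t ht
    exact ⟨l.1, (continuous_fst.tendsto l).comp hl⟩⟩

lemma CadlagOn.csnd {f g : ℝ → ℝ} (h : CadlagOn (fun t => (f t, g t))) : CadlagOn g :=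
  ⟨fun t ht => (h.1 t ht).snd, fun t ht => by
    obtain ⟨l, hl⟩ := h.2 t ht
    exact ⟨l.2, (continuous_snd.tendsto l).comp hl⟩⟩

lemma CadlagOn.pair {f g : ℝ → ℝ} (hf : CadlagOn f) (hg : CadlagOn g) :
    CadlagOn (fun t => (f t, g t)) :=
  ⟨fun t ht => (hf.1 t ht).prodMk (hg.1 t ht), fun t ht => by
    obtain ⟨l, hl⟩ := hf.2 t ht
    obtain ⟨m, hm⟩ := hg.2 t ht
    exact ⟨(l, m), hl.prodMk_nhds hm⟩⟩

lemma CadlagOn.sum {f g : ℝ → ℝ} (hf : CadlagOn f) (hg : CadlagOn g) :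
    CadlagOn (fun t => f t + g t) :=
  ⟨fun t ht => (hf.1 t ht).add (hg.1 t ht), fun t ht => by
    obtain ⟨l, hl⟩ := hf.2 t ht
    obtain ⟨m, hm⟩ := hg.2 t ht
    exact ⟨l + m, hl.add hm⟩⟩

lemma CadlagOn.diff {f g : ℝ → ℝ} (hf : CadlagOn f) (hg : CadlagOn g) :
    CadlagOn (fun t => f t - g t) :=
  ⟨fun t ht => (hf.1 t ht).sub (hg.1 t ht), fun t ht => by
    obtain ⟨l, hl⟩ := hf.2 t ht
    obtain ⟨m, hm⟩ := hg.2 t ht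
    exact ⟨l - m, hl.sub hm⟩⟩

lemma cadlagOn_const (c : ℝ) : CadlagOn (fun _ : ℝ => c) :=
  ⟨fun _ _ => continuousWithinAt_const, fun _ _ => ⟨c, tendsto_const_nhds⟩⟩

lemma cadlagOn_of_continuousOn {f : ℝ → ℝ} (hf : ContinuousOn f (Ici 0)) : CadlagOn f :=
  ⟨fun t ht => (hf t ht).mono (Ici_subset_Ici.2 ht), fun t ht =>
    ⟨f t, ((hf t ht.le).continuousAt (Ici_mem_nhds ht)).tendsto.mono_left nhdsWithin_le_nhds⟩⟩

lemma CadlagOn.bdd {f : ℝ → ℝ} (hf : CadlagOn f) (T : ℝ) :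
    ∃ M, 0 ≤ M ∧ ∀ s ∈ Icc (0:ℝ) T, |f s| ≤ M := by
  refine isCompact_Icc.induction_on
    (p := fun S => ∃ M, 0 ≤ M ∧ ∀ s ∈ S, |f s| ≤ M) ⟨0, le_rfl, by simp⟩ ?_ ?_ ?_
  · rintro s t hst ⟨M, hM, h⟩
    exact ⟨M, hM, fun x hx => h x (hst hx)⟩
  · rintro s t ⟨M, hM, h⟩ ⟨N, hN, h'⟩
    refine ⟨max M N, le_max_of_le_left hM, ?_⟩
    rintro x (hx | hx)
    · exact (h x hx).trans (le_max_left _ _)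
    · exact (h' x hx).trans (le_max_right _ _)
  · intro x hx
    have hr : ∀ᶠ y in 𝓝[≥] x, |f y| < |f x| + 1 :=
      (hf.1 x hx.1).abs.eventually (gt_mem_nhds (lt_add_one |f x|))
    rcases hx.1.eq_or_lt with h0 | h0
    · subst h0
      refine ⟨_, nhdsWithin_mono _ Icc_subset_Ici_self hr, |f 0| + 1, by positivity,
        fun s hs => le_of_lt hs⟩
    · obtain ⟨l, hl⟩ := hf.2 x h0
      have hL : ∀ᶠ y in 𝓝[<] x, |f y| < |l| + 1 :=
        hl.abs.eventually (gt_mem_nhds (lt_add_one |l|))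
      have : ∀ᶠ y in 𝓝 x, |f y| < max (|l| + 1) (|f x| + 1) := by
        rw [← nhdsLT_sup_nhdsGE, eventually_sup]
        exact ⟨hL.mono fun y hy => lt_max_of_lt_left hy,
          hr.mono fun y hy => lt_max_of_lt_right hy⟩
      exact ⟨_, mem_nhdsWithin_of_mem_nhds this, max (|l| + 1) (|f x| + 1), by positivity,
        fun s hs => le_of_lt hs⟩

lemma CadlagOn.aesm {f : ℝ → ℝ} (hf : CadlagOn f) :
    AEStronglyMeasurable f (volume.restrict (Ici 0)) := by
  refine aestronglyMeasurable_of_tendsto_ae (u := atTop)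
    (f := fun (k : ℕ) t => f (((⌊((k:ℝ)+1) * t⌋ : ℝ) + 1) / ((k:ℝ)+1))) ?_ ?_
  · intro k
    have h1 : Measurable (fun n : ℤ => f (((n : ℝ) + 1) / ((k:ℝ)+1))) := measurable_from_top
    have h2 : Measurable (fun t : ℝ => ⌊((k:ℝ)+1) * t⌋) :=
      Int.measurable_floor.comp (measurable_const.mul measurable_id)
    exact (h1.comp h2).aestronglyMeasurable
  · refine (ae_restrict_iff' measurableSet_Ici).2 (Eventually.of_forall fun t ht => ?_)
    refine (hf.1 t ht).tendsto.comp (tendsto_nhdsWithin_iff.2 ⟨?_, Eventually.of_forall ?_⟩)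
    · have h3 : Tendsto (fun k : ℕ => t + 1 / ((k:ℝ)+1)) atTop (𝓝 t) := by
        simpa using (tendsto_const_nhds (x := t)).add
          (tendsto_one_div_add_atTop_nhds_zero_nat (𝕜 := ℝ))
      refine tendsto_of_tendsto_of_tendsto_of_le_of_le tendsto_const_nhds h3 ?_ ?_
      · intro k
        have hk : (0:ℝ) < (k:ℝ)+1 := by positivity
        have := Int.lt_floor_add_one (((k:ℝ)+1) * t)
        simp only
        rw [le_div_iff₀ hk]; linarith
      · intro k
        have hk : (0:ℝ) < (k:ℝ)+1 := by positivity
        have := Int.floor_le (((k:ℝ)+1) * t)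
        simp only
        have h4 : (t + 1 / ((k:ℝ)+1)) * ((k:ℝ)+1) = ((k:ℝ)+1) * t + 1 := by field_simp
        rw [div_le_iff₀ hk, h4]; linarith
    · intro k
      have hk : (0:ℝ) < (k:ℝ)+1 := by positivity
      have := Int.lt_floor_add_one (((k:ℝ)+1) * t)
      simp only [mem_Ici]
      rw [le_div_iff₀ hk]; linarith

lemma CadlagOn.ii {f : ℝ → ℝ} (hf : CadlagOn f) {T : ℝ} (hT : 0 ≤ T) :
    IntervalIntegrable f volume 0 T := by
  rw [intervalIntegrable_iff_integrableOn_Ioc_of_le hT]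
  obtain ⟨M, -, hM⟩ := hf.bdd T
  refine IntegrableOn.of_bound (by simp)
    (hf.aesm.mono_measure (Measure.restrict_mono (fun x hx => hx.1.le) le_rfl)) M ?_
  exact (ae_restrict_iff' measurableSet_Ioc).2
    (Eventually.of_forall fun t ht => hM t ⟨ht.1.le, ht.2⟩)

/-! reflection map -/

lemma psi_bddAbove {κ : ℝ} {x : ℝ → ℝ} (hx : CadlagOn x) (t : ℝ) :
    BddAbove ((fun u => max (x u - κ) 0) '' Icc (0:ℝ) t) := by
  obtain ⟨M, -, hM⟩ := hx.bdd t
  refine ⟨max (M - κ) 0, ?_⟩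
  rintro _ ⟨u, hu, rfl⟩
  have := (abs_le.1 (hM u hu)).2
  exact max_le_max (by linarith) le_rfl

lemma le_psi {κ : ℝ} {x : ℝ → ℝ} (hx : CadlagOn x) {t u : ℝ} (hu : u ∈ Icc (0:ℝ) t) :
    max (x u - κ) 0 ≤ psiRefl κ x t :=
  le_csSup (psi_bddAbove hx t) ⟨u, hu, rfl⟩

lemma psi_nonneg {κ : ℝ} {x : ℝ → ℝ} (t : ℝ) : 0 ≤ psiRefl κ x t := by
  apply Real.sSup_nonneg
  rintro _ ⟨u, _, rfl⟩
  exact le_max_right _ _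

lemma psi_le {κ : ℝ} {x : ℝ → ℝ} {t c : ℝ} (hc : 0 ≤ c)
    (h : ∀ u ∈ Icc (0:ℝ) t, x u - κ ≤ c) : psiRefl κ x t ≤ c := by
  apply Real.sSup_le _ hc
  rintro _ ⟨u, hu, rfl⟩
  exact max_le (h u hu) hc

lemma psi_mono {κ : ℝ} {x : ℝ → ℝ} (hx : CadlagOn x) : Monotone (psiRefl κ x) :=
  fun s t hst => psi_le (psi_nonneg t) fun _ hu =>
    (le_max_left _ _).trans (le_psi hx ⟨hu.1, hu.2.trans hst⟩)

lemma psi_modulus {κ : ℝ} {x : ℝ → ℝ} (hx : CadlagOn x) {u t ε : ℝ} (h0 : 0 ≤ u)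
    (hε : 0 ≤ ε) (h : ∀ r ∈ Icc u t, x r ≤ x u + ε) : psiRefl κ x t ≤ psiRefl κ x u + ε := by
  refine psi_le (add_nonneg (psi_nonneg u) hε) fun r hr => ?_
  rcases le_total r u with hru | hru
  · have := (le_max_left _ _).trans (le_psi (κ := κ) hx (t := u) ⟨hr.1, hru⟩)
    linarith
  · have := (le_max_left _ _).trans (le_psi (κ := κ) hx (t := u) ⟨h0, le_rfl⟩)
    have := h r ⟨hru, hr.2⟩
    linarith

lemma psi_lip {κ : ℝ} {x y : ℝ → ℝ} (hx : CadlagOn x) (hy : CadlagOn y) {t M : ℝ} (ht : 0 ≤ t)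
    (h : ∀ r ∈ Icc (0:ℝ) t, |x r - y r| ≤ M) : |psiRefl κ x t - psiRefl κ y t| ≤ M := by
  have hM : 0 ≤ M := (abs_nonneg _).trans (h 0 ⟨le_rfl, ht⟩)
  have key : ∀ x y : ℝ → ℝ, CadlagOn y → (∀ r ∈ Icc (0:ℝ) t, |x r - y r| ≤ M) →
      psiRefl κ x t ≤ psiRefl κ y t + M := by
    intro x y hy h
    refine psi_le (add_nonneg (psi_nonneg t) hM) fun r hr => ?_
    have h1 := (le_max_left _ _).trans (le_psi (κ := κ) hy hr)
    have h2 := (abs_le.1 (h r hr)).2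
    linarith
  have h1 := key x y hy h
  have h2 := key y x hx (fun r hr => by rw [abs_sub_comm]; exact h r hr)
  rw [abs_le]; constructor <;> linarith

lemma psi_congr {κ : ℝ} {x y : ℝ → ℝ} {t : ℝ} (h : ∀ r ∈ Icc (0:ℝ) t, x r = y r) :
    psiRefl κ x t = psiRefl κ y t := by
  unfold psiRefl
  congr 1
  exact image_congr fun r hr => by simp only [h r hr]

lemma psi_cadlag {κ : ℝ} {x : ℝ → ℝ} (hx : CadlagOn x) : CadlagOn (psiRefl κ x) := by
  refine ⟨fun t ht => ?_, fun t _ => ⟨_, (psi_mono hx).tendsto_nhdsLT t⟩⟩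
  rw [Metric.continuousWithinAt_iff]
  intro ε hε
  obtain ⟨δ, hδ, h⟩ := Metric.continuousWithinAt_iff.1 (hx.1 t ht) (ε / 2) (by positivity)
  refine ⟨δ, hδ, fun s hs hsd => ?_⟩
  have h1 := psi_mono (κ := κ) hx (mem_Ici.1 hs)
  have h2 : psiRefl κ x s ≤ psiRefl κ x t + ε / 2 := by
    refine psi_modulus hx ht (by positivity) fun r hr => ?_
    have := h (x := r) hr.1 (by
      rw [Real.dist_eq, abs_lt] at *; constructor <;> linarith [hr.1, hr.2])
    rw [Real.dist_eq, abs_lt] at this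
    linarith
  rw [Real.dist_eq, abs_lt]; constructor <;> linarith

lemma psi_continuousOn {κ : ℝ} {x : ℝ → ℝ} (hx : ContinuousOn x (Ici 0)) :
    ContinuousOn (psiRefl κ x) (Ici 0) := by
  have hc := cadlagOn_of_continuousOn hx
  intro t ht
  rw [Metric.continuousWithinAt_iff]
  intro ε hε
  obtain ⟨δ, hδ, h⟩ := Metric.continuousWithinAt_iff.1 (hx t ht) (ε / 4) (by positivity)
  have key : ∀ u v : ℝ, 0 ≤ u → u ≤ v → |u - t| < δ → |v - t| < δ →
      psiRefl κ x v ≤ psiRefl κ x u + ε / 2 := by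
    intro u v h0 huv hu hv
    refine psi_modulus hc h0 (by positivity) fun r hr => ?_
    have h1 := h (x := r) (h0.trans hr.1) (by
      rw [Real.dist_eq]; rw [abs_lt] at *; constructor <;> linarith [hr.1, hr.2])
    have h2 := h (x := u) h0 hu
    rw [Real.dist_eq, abs_lt] at h1 h2
    linarith
  refine ⟨δ, hδ, fun s hs hsd => ?_⟩
  rw [Real.dist_eq] at hsd
  rw [Real.dist_eq, abs_lt]
  rcases le_total s t with hst | hst
  · have := key s t hs hst hsd (by simpa)
    have := psi_mono (κ := κ) hc hst
    constructor <;> linarith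
  · have := key t s ht hst (by simpa) hsd
    have := psi_mono (κ := κ) hc hst
    constructor <;> linarith

lemma phiRefl_cadlag {κ : ℝ} {x : ℝ → ℝ} (hx : CadlagOn x) : CadlagOn (phiRefl κ x) :=
  hx.diff (psi_cadlag hx)

lemma phiBar_cadlag {B : ENNReal} {x : ℝ → ℝ} (hx : CadlagOn x) : CadlagOn (phiBar B x) := by
  have h : CadlagOn (psiBar B x) := by
    by_cases hB : B = ⊤
    · have : psiBar B x = fun _ => 0 := by funext t; simp [psiBar, hB]
      rw [this]; exact cadlagOn_const 0
    · have : psiBar B x = psiRefl B.toReal x := by funext t; simp [psiBar, hB]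
      rw [this]; exact psi_cadlag hx
  exact hx.diff h

lemma phiRefl_lip {κ : ℝ} {x y : ℝ → ℝ} (hx : CadlagOn x) (hy : CadlagOn y) {t M : ℝ}
    (ht : 0 ≤ t) (h : ∀ r ∈ Icc (0:ℝ) t, |x r - y r| ≤ M) :
    |phiRefl κ x t - phiRefl κ y t| ≤ 2 * M := by
  have h1 := psi_lip (κ := κ) hx hy ht h
  have h2 := h t ⟨ht, le_rfl⟩
  unfold phiRefl
  rw [abs_le] at *; constructor <;> linarith

lemma phiBar_lip {B : ENNReal} {x y : ℝ → ℝ} (hx : CadlagOn x) (hy : CadlagOn y) {t M : ℝ}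
    (ht : 0 ≤ t) (h : ∀ r ∈ Icc (0:ℝ) t, |x r - y r| ≤ M) :
    |phiBar B x t - phiBar B y t| ≤ 2 * M := by
  have h2 := h t ⟨ht, le_rfl⟩
  have hM : 0 ≤ M := (abs_nonneg _).trans h2
  have h1 : |psiBar B x t - psiBar B y t| ≤ M := by
    by_cases hB : B = ⊤
    · simpa [psiBar, hB] using hM
    · simpa [psiBar, hB] using psi_lip (κ := B.toReal) hx hy ht h
  unfold phiBar
  rw [abs_le] at *; constructor <;> linarith

lemma phiRefl_congr {κ : ℝ} {x y : ℝ → ℝ} {t : ℝ} (ht : 0 ≤ t)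
    (h : ∀ r ∈ Icc (0:ℝ) t, x r = y r) : phiRefl κ x t = phiRefl κ y t := by
  unfold phiRefl
  rw [h t ⟨ht, le_rfl⟩, psi_congr h]

lemma phiBar_congr {B : ENNReal} {x y : ℝ → ℝ} {t : ℝ} (ht : 0 ≤ t)
    (h : ∀ r ∈ Icc (0:ℝ) t, x r = y r) : phiBar B x t = phiBar B y t := by
  unfold phiBar psiBar
  rw [h t ⟨ht, le_rfl⟩, psi_congr h]

/-! abstract causal Volterra equation -/

section Volterra

variable {E : Type*} [NormedAddCommGroup E] [NormedSpace ℝ E] [CompleteSpace E]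

lemma primitive_continuousOn {g : ℝ → E}
    (h : ∀ T, 0 ≤ T → IntervalIntegrable g volume 0 T) :
    ContinuousOn (fun t => ∫ s in (0:ℝ)..t, g s) (Ici 0) := by
  intro t ht
  have ht : (0:ℝ) ≤ t := ht
  have h1 := intervalIntegral.continuousOn_primitive_interval' (h (t + 1) (by linarith))
    (left_mem_uIcc)
  rw [uIcc_of_le (by linarith)] at h1
  refine (h1 t ⟨ht, by linarith⟩).mono_of_mem_nhdsWithin ?_
  have : Iio (t + 1) ∈ 𝓝 t := Iio_mem_nhds (by linarith)
  filter_upwards [self_mem_nhdsWithin, mem_nhdsWithin_of_mem_nhds this] with s h1 h2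
  exact ⟨h1, le_of_lt h2⟩

variable (G : (ℝ → E) → ℝ → E) (L : ℝ)

lemma volterra_step (hL : 0 ≤ L)
    (hint : ∀ y, ContinuousOn y (Ici 0) → ∀ T, 0 ≤ T → IntervalIntegrable (G y) volume 0 T)
    (hlip : ∀ y y', ContinuousOn y (Ici 0) → ContinuousOn y' (Ici 0) → ∀ s, 0 ≤ s → ∀ M,
      (∀ r ∈ Icc (0:ℝ) s, ‖y r - y' r‖ ≤ M) → ‖G y s - G y' s‖ ≤ L * M)
    {y y' : ℝ → E} (hy : ContinuousOn y (Ici 0)) (hy' : ContinuousOn y' (Ici 0))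
    {T K : ℝ} (hK : 0 ≤ K) (n : ℕ)
    (h : ∀ s ∈ Icc (0:ℝ) T, ‖y s - y' s‖ ≤ K * ((L * s) ^ n / n.factorial)) :
    ∀ t ∈ Icc (0:ℝ) T, ‖(∫ s in (0:ℝ)..t, G y s) - ∫ s in (0:ℝ)..t, G y' s‖ ≤
      K * ((L * t) ^ (n + 1) / (n + 1).factorial) := by
  intro t ht
  rw [← intervalIntegral.integral_sub (hint y hy t ht.1) (hint y' hy' t ht.1)]
  have e : ∫ s in (0:ℝ)..t, L * (K * ((L * s) ^ n / n.factorial)) =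
      K * ((L * t) ^ (n + 1) / (n + 1).factorial) := by
    have : ∀ s : ℝ, L * (K * ((L * s) ^ n / n.factorial)) =
        (L * K * L ^ n / n.factorial) * s ^ n := by intro s; rw [mul_pow]; ring
    simp_rw [this]
    rw [intervalIntegral.integral_const_mul, integral_pow, Nat.factorial_succ]
    have : (n.factorial : ℝ) ≠ 0 := by positivity
    have : (n:ℝ) + 1 ≠ 0 := by positivity
    push_cast
    field_simp
    ring
  rw [← e]
  refine intervalIntegral.norm_integral_le_of_norm_le ht.1 (Eventually.of_forall fun s hs => ?_)
    (Continuous.intervalIntegrable (by fun_prop) _ _)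
  refine hlip y y' hy hy' s hs.1.le _ fun r hr => ?_
  refine (h r ⟨hr.1, hr.2.trans (hs.2.trans ht.2)⟩).trans ?_
  have := hr.1
  have := hr.2
  gcongr

lemma volterra_unique (hL : 0 ≤ L)
    (hint : ∀ y, ContinuousOn y (Ici 0) → ∀ T, 0 ≤ T → IntervalIntegrable (G y) volume 0 T)
    (hlip : ∀ y y', ContinuousOn y (Ici 0) → ContinuousOn y' (Ici 0) → ∀ s, 0 ≤ s → ∀ M,
      (∀ r ∈ Icc (0:ℝ) s, ‖y r - y' r‖ ≤ M) → ‖G y s - G y' s‖ ≤ L * M)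
    {y y' : ℝ → E} (hy : ContinuousOn y (Ici 0)) (hy' : ContinuousOn y' (Ici 0))
    (e : ∀ t, 0 ≤ t → y t = ∫ s in (0:ℝ)..t, G y s)
    (e' : ∀ t, 0 ≤ t → y' t = ∫ s in (0:ℝ)..t, G y' s) :
    ∀ t, 0 ≤ t → y t = y' t := by
  intro T hT
  obtain ⟨K, hK⟩ := isCompact_Icc.exists_bound_of_continuousOn
    ((hy.sub hy').mono (Icc_subset_Ici_self : Icc (0:ℝ) T ⊆ Ici 0))
  have hK0 : 0 ≤ K := (norm_nonneg _).trans (hK 0 ⟨le_rfl, hT⟩)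
  have key : ∀ n : ℕ, ∀ s ∈ Icc (0:ℝ) T, ‖y s - y' s‖ ≤ K * ((L * s) ^ n / n.factorial) := by
    intro n
    induction n with
    | zero => intro s hs; simpa using hK s hs
    | succ n ih =>
      intro s hs
      rw [e s hs.1, e' s hs.1]
      exact volterra_step G L hL hint hlip hy hy' hK0 n ih s hs
  have lim : Tendsto (fun n : ℕ => K * ((L * T) ^ n / n.factorial)) atTop (𝓝 (K * 0)) :=
    (FloorSemiring.tendsto_pow_div_factorial_atTop (L * T)).const_mul K
  have := ge_of_tendsto' lim (fun n => key n T ⟨hT, le_rfl⟩)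
  rw [mul_zero] at this
  exact sub_eq_zero.1 (norm_le_zero_iff.1 this)

/-- Picard iterates. -/
noncomputable def picIter : ℕ → ℝ → E
  | 0 => fun _ => 0
  | n + 1 => fun t => ∫ s in (0:ℝ)..t, G (picIter n) s

lemma volterra_exists (hL : 0 ≤ L)
    (hint : ∀ y, ContinuousOn y (Ici 0) → ∀ T, 0 ≤ T → IntervalIntegrable (G y) volume 0 T)
    (hlip : ∀ y y', ContinuousOn y (Ici 0) → ContinuousOn y' (Ici 0) → ∀ s, 0 ≤ s → ∀ M,
      (∀ r ∈ Icc (0:ℝ) s, ‖y r - y' r‖ ≤ M) → ‖G y s - G y' s‖ ≤ L * M) :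
    ∃ y : ℝ → E, ContinuousOn y (Ici 0) ∧ ∀ t, 0 ≤ t → y t = ∫ s in (0:ℝ)..t, G y s := by
  have hc : ∀ n, ContinuousOn (picIter G n) (Ici 0) := by
    intro n
    induction n with
    | zero => exact continuousOn_const
    | succ n ih => exact primitive_continuousOn (hint _ ih)
  have hstep : ∀ T, 0 ≤ T → ∃ K, 0 ≤ K ∧ ∀ n : ℕ, ∀ s ∈ Icc (0:ℝ) T,
      ‖picIter G (n + 1) s - picIter G n s‖ ≤ K * ((L * s) ^ n / n.factorial) := by
    intro T hT
    obtain ⟨K, hK⟩ := isCompact_Icc.exists_bound_of_continuousOn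
      (((hc 1).sub (hc 0)).mono (Icc_subset_Ici_self : Icc (0:ℝ) T ⊆ Ici 0))
    have hK0 : 0 ≤ K := (norm_nonneg _).trans (hK 0 ⟨le_rfl, hT⟩)
    refine ⟨K, hK0, fun n => ?_⟩
    induction n with
    | zero => intro s hs; simpa using hK s hs
    | succ n ih =>
      intro s hs
      exact volterra_step G L hL hint hlip (hc _) (hc _) hK0 n ih s hs
  -- uniform convergence on compacts
  have hunif : ∃ y : ℝ → E, ∀ T, 0 ≤ T → ∃ a : ℕ → ℝ, Tendsto a atTop (𝓝 0) ∧
      ∀ n, ∀ s ∈ Icc (0:ℝ) T, ‖picIter G n s - y s‖ ≤ a n := by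
    have hpt : ∀ T, 0 ≤ T → ∃ d : ℕ → ℝ, Summable d ∧ ∀ n : ℕ, ∀ s ∈ Icc (0:ℝ) T,
        dist (picIter G n s) (picIter G (n + 1) s) ≤ d n := by
      intro T hT
      obtain ⟨K, hK0, hK⟩ := hstep T hT
      refine ⟨fun n => K * ((L * T) ^ n / n.factorial),
        (Real.summable_pow_div_factorial (L * T)).mul_left K, fun n s hs => ?_⟩
      rw [dist_comm, dist_eq_norm]
      refine (hK n s hs).trans ?_
      show K * ((L * s) ^ n / n.factorial) ≤ K * ((L * T) ^ n / n.factorial)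
      have := hs.1
      have := hs.2
      gcongr
    have hlim : ∀ t : ℝ, ∃ l : E, 0 ≤ t → Tendsto (fun n => picIter G n t) atTop (𝓝 l) := by
      intro t
      by_cases ht : 0 ≤ t
      · obtain ⟨d, hd, h⟩ := hpt t ht
        obtain ⟨l, hl⟩ := cauchySeq_tendsto_of_complete
          (cauchySeq_of_dist_le_of_summable d (fun n => h n t ⟨ht, le_rfl⟩) hd)
        exact ⟨l, fun _ => hl⟩
      · exact ⟨0, fun h => absurd h ht⟩
    choose y hy using hlim
    refine ⟨y, fun T hT => ?_⟩
    obtain ⟨d, hd, h⟩ := hpt T hT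
    refine ⟨fun n => ∑' m, d (n + m), ?_, fun n s hs => ?_⟩
    · simpa [add_comm] using tendsto_sum_nat_add d
    · rw [← dist_eq_norm]
      exact dist_le_tsum_of_dist_le_of_tendsto d (fun n => h n s hs) hd (hy s hs.1) n
  obtain ⟨y, hy⟩ := hunif
  have hyc : ContinuousOn y (Ici 0) := by
    intro t ht
    have ht : (0:ℝ) ≤ t := ht
    obtain ⟨a, ha, h⟩ := hy (t + 1) (by linarith)
    have hu : TendstoUniformlyOn (picIter G) y atTop (Icc 0 (t + 1)) := by
      rw [Metric.tendstoUniformlyOn_iff]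
      intro ε hε
      filter_upwards [ha.eventually (gt_mem_nhds hε)] with n hn s hs
      rw [dist_comm, dist_eq_norm]
      exact (h n s hs).trans_lt hn
    have h1 := hu.continuousOn
      (Eventually.of_forall fun n => (hc n).mono Icc_subset_Ici_self).frequently
    refine (h1 t ⟨ht, by linarith⟩).mono_of_mem_nhdsWithin ?_
    have : Iio (t + 1) ∈ 𝓝 t := Iio_mem_nhds (by linarith)
    filter_upwards [self_mem_nhdsWithin, mem_nhdsWithin_of_mem_nhds this] with s h1 h2
    exact ⟨h1, le_of_lt h2⟩
  refine ⟨y, hyc, fun t ht => ?_⟩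
  obtain ⟨a, ha, h⟩ := hy t ht
  have l1 : Tendsto (fun n => picIter G (n + 1) t) atTop (𝓝 (y t)) := by
    rw [tendsto_iff_norm_sub_tendsto_zero]
    exact squeeze_zero (fun _ => norm_nonneg _) (fun n => h (n + 1) t ⟨ht, le_rfl⟩)
      (ha.comp (tendsto_add_atTop_nat 1))
  have l2 : Tendsto (fun n => picIter G (n + 1) t) atTop (𝓝 (∫ s in (0:ℝ)..t, G y s)) := by
    rw [tendsto_iff_norm_sub_tendsto_zero]
    have l3 : Tendsto (fun n => a n * (L * t)) atTop (𝓝 0) := by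
      simpa using ha.mul_const (L * t)
    refine squeeze_zero (fun _ => norm_nonneg _) (fun n => ?_) l3
    have ha0 : 0 ≤ a n := (norm_nonneg _).trans (h n t ⟨ht, le_rfl⟩)
    have := volterra_step G L hL hint hlip (hc n) hyc (T := t) ha0 0
      (fun s hs => by simpa using h n s hs) t ⟨ht, le_rfl⟩
    simpa [picIter] using this
  exact tendsto_nhds_unique l1 l2

end Volterra

/-- First component of the candidate solution. -/
def solA (b₁ : ℝ) (z₁ : ℝ → ℝ) (y : ℝ → ℝ × ℝ) (t : ℝ) : ℝ := b₁ + z₁ t - (y t).1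

/-- Second component of the candidate solution. -/
noncomputable def solB (b₁ b₂ : ℝ) (z₁ z₂ : ℝ → ℝ) (y : ℝ → ℝ × ℝ) (t : ℝ) : ℝ :=
  b₂ + z₂ t + psiRefl 0 (solA b₁ z₁ y) t - (y t).2

/-- The causal vector field. -/
noncomputable def fieldG (μ₁ μM : ℝ) (B : ENNReal) (b₁ b₂ : ℝ) (z₁ z₂ : ℝ → ℝ)
    (y : ℝ → ℝ × ℝ) (s : ℝ) : ℝ × ℝ :=
  (μM * phiRefl 0 (solA b₁ z₁ y) s - μ₁ * phiBar B (solB b₁ b₂ z₁ z₂ y) s,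
    μ₁ * phiBar B (solB b₁ b₂ z₁ z₂ y) s)

lemma CadlagOn.cmul {f : ℝ → ℝ} (c : ℝ) (hf : CadlagOn f) : CadlagOn (fun t => c * f t) :=
  ⟨fun t ht => (hf.1 t ht).const_mul c, fun t ht => by
    obtain ⟨l, hl⟩ := hf.2 t ht
    exact ⟨c * l, hl.const_mul c⟩⟩

lemma solA_cadlag {b₁ : ℝ} {z₁ : ℝ → ℝ} (hz : CadlagOn z₁) {y : ℝ → ℝ × ℝ}
    (hy : ContinuousOn y (Ici 0)) : CadlagOn (solA b₁ z₁ y) :=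
  ((cadlagOn_const b₁).sum hz).diff (cadlagOn_of_continuousOn hy.fst)

lemma solB_cadlag {b₁ b₂ : ℝ} {z₁ z₂ : ℝ → ℝ} (hz : CadlagOn z₁) (hz₂ : CadlagOn z₂)
    {y : ℝ → ℝ × ℝ} (hy : ContinuousOn y (Ici 0)) : CadlagOn (solB b₁ b₂ z₁ z₂ y) :=
  (((cadlagOn_const b₂).sum hz₂).sum (psi_cadlag (solA_cadlag hz hy))).diff
    (cadlagOn_of_continuousOn hy.snd)

lemma pair_ii {f g : ℝ → ℝ} {a b : ℝ} (hf : IntervalIntegrable f volume a b)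
    (hg : IntervalIntegrable g volume a b) :
    IntervalIntegrable (fun t => (f t, g t)) volume a b :=
  ⟨hf.1.prodMk hg.1, hf.2.prodMk hg.2⟩

lemma pair_integral {f g : ℝ → ℝ} {a b : ℝ} (hf : IntervalIntegrable f volume a b)
    (hg : IntervalIntegrable g volume a b) :
    ∫ t in a..b, (f t, g t) = (∫ t in a..b, f t, ∫ t in a..b, g t) := by
  simp only [intervalIntegral]
  rw [integral_pair hf.1 hg.1, integral_pair hf.2 hg.2]
  rfl

/-- Existence, uniqueness (on `[0,∞)`) and continuity-transfer for the
internally reflected integral equations (Lemma 4 of the paper). -/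
theorem truncated_system_exists_unique
    (μ₁ μM : ℝ) (hμ : μM ≤ μ₁) (hμM : 0 < μM)
    (B : ENNReal) (b₁ b₂ : ℝ) (z₁ z₂ : ℝ → ℝ)
    (hz : CadlagOn (fun t => (z₁ t, z₂ t))) :
    (∃ w₁ w₂ : ℝ → ℝ, IsTruncSol μ₁ μM B b₁ b₂ z₁ z₂ w₁ w₂) ∧
    (∀ w₁ w₂ v₁ v₂ : ℝ → ℝ,
      IsTruncSol μ₁ μM B b₁ b₂ z₁ z₂ w₁ w₂ →
      IsTruncSol μ₁ μM B b₁ b₂ z₁ z₂ v₁ v₂ →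
      ∀ t, 0 ≤ t → w₁ t = v₁ t ∧ w₂ t = v₂ t) ∧
    (ContinuousOn (fun t => (z₁ t, z₂ t)) (Set.Ici 0) →
      ∀ w₁ w₂ : ℝ → ℝ, IsTruncSol μ₁ μM B b₁ b₂ z₁ z₂ w₁ w₂ →
        ContinuousOn (fun t => (w₁ t, w₂ t)) (Set.Ici 0)) := by
  have hz1 := hz.cfst
  have hz2 := hz.csnd
  have hμ1 : 0 < μ₁ := hμM.trans_le hμ
  have iiA : ∀ w₁ w₂ : ℝ → ℝ, CadlagOn w₁ → CadlagOn w₂ → ∀ T, 0 ≤ T →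
      IntervalIntegrable (fun s => μM * phiRefl 0 w₁ s - μ₁ * phiBar B w₂ s) volume 0 T :=
    fun w₁ w₂ h1 h2 T hT =>
      (((phiRefl_cadlag h1).cmul μM).diff ((phiBar_cadlag h2).cmul μ₁)).ii hT
  have iiB : ∀ w₂ : ℝ → ℝ, CadlagOn w₂ → ∀ T, 0 ≤ T →
      IntervalIntegrable (fun s => μ₁ * phiBar B w₂ s) volume 0 T :=
    fun w₂ h2 T hT => ((phiBar_cadlag h2).cmul μ₁).ii hT
  have hint : ∀ y, ContinuousOn y (Ici 0) → ∀ T, 0 ≤ T →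
      IntervalIntegrable (fieldG μ₁ μM B b₁ b₂ z₁ z₂ y) volume 0 T := fun y hy T hT =>
    pair_ii (iiA _ _ (solA_cadlag hz1 hy) (solB_cadlag hz1 hz2 hy) T hT)
      (iiB _ (solB_cadlag hz1 hz2 hy) T hT)
  have hlip : ∀ y y', ContinuousOn y (Ici 0) → ContinuousOn y' (Ici 0) → ∀ s, 0 ≤ s → ∀ M,
      (∀ r ∈ Icc (0:ℝ) s, ‖y r - y' r‖ ≤ M) →
      ‖fieldG μ₁ μM B b₁ b₂ z₁ z₂ y s - fieldG μ₁ μM B b₁ b₂ z₁ z₂ y' s‖ ≤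
        (2 * μM + 4 * μ₁) * M := by
    intro y y' hy hy' s hs M h
    have hM : 0 ≤ M := (norm_nonneg _).trans (h s ⟨hs, le_rfl⟩)
    have h1 : ∀ r ∈ Icc (0:ℝ) s, |(y r).1 - (y' r).1| ≤ M := fun r hr =>
      (norm_fst_le (y r - y' r)).trans (h r hr)
    have h2 : ∀ r ∈ Icc (0:ℝ) s, |(y r).2 - (y' r).2| ≤ M := fun r hr =>
      (norm_snd_le (y r - y' r)).trans (h r hr)
    have hA : ∀ r ∈ Icc (0:ℝ) s, |solA b₁ z₁ y r - solA b₁ z₁ y' r| ≤ M := by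
      intro r hr
      have := h1 r hr
      unfold solA
      rw [abs_le] at *; constructor <;> linarith
    have hB : ∀ r ∈ Icc (0:ℝ) s,
        |solB b₁ b₂ z₁ z₂ y r - solB b₁ b₂ z₁ z₂ y' r| ≤ 2 * M := by
      intro r hr
      have h3 := h2 r hr
      have h4 := psi_lip (κ := 0) (solA_cadlag (b₁ := b₁) hz1 hy)
        (solA_cadlag (b₁ := b₁) hz1 hy') hr.1
        (fun u hu => hA u ⟨hu.1, hu.2.trans hr.2⟩)
      unfold solB
      rw [abs_le] at *; constructor <;> linarith
    have pA := phiRefl_lip (κ := 0) (solA_cadlag hz1 hy) (solA_cadlag hz1 hy') hs hA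
    have pB := phiBar_lip (B := B) (solB_cadlag hz1 hz2 hy) (solB_cadlag hz1 hz2 hy') hs hB
    unfold fieldG
    generalize phiRefl 0 (solA b₁ z₁ y) s = p at *
    generalize phiRefl 0 (solA b₁ z₁ y') s = p' at *
    generalize phiBar B (solB b₁ b₂ z₁ z₂ y) s = q at *
    generalize phiBar B (solB b₁ b₂ z₁ z₂ y') s = q' at *
    rw [abs_le] at pA pB
    have a1 := mul_le_mul_of_nonneg_left pA.1 hμM.le
    have a2 := mul_le_mul_of_nonneg_left pA.2 hμM.le
    have a3 := mul_le_mul_of_nonneg_left pB.1 hμ1.le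
    have a4 := mul_le_mul_of_nonneg_left pB.2 hμ1.le
    have a5 := mul_nonneg hμM.le hM
    rw [Prod.mk_sub_mk, Prod.norm_def, max_le_iff]
    simp only [Real.norm_eq_abs, abs_le]
    refine ⟨⟨?_, ?_⟩, ?_, ?_⟩ <;> linarith
  have hL : 0 ≤ 2 * μM + 4 * μ₁ := by positivity
  -- continuity of the integral parts of a solution
  have hprim : ∀ w₁ w₂ : ℝ → ℝ, IsTruncSol μ₁ μM B b₁ b₂ z₁ z₂ w₁ w₂ →
      ContinuousOn (fun t => (∫ s in (0:ℝ)..t, (μM * phiRefl 0 w₁ s - μ₁ * phiBar B w₂ s),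
        ∫ s in (0:ℝ)..t, μ₁ * phiBar B w₂ s)) (Ici 0) := fun w₁ w₂ hw =>
    (primitive_continuousOn (iiA _ _ hw.1.cfst hw.1.csnd)).prodMk
      (primitive_continuousOn (iiB _ hw.1.csnd))
  refine ⟨?_, ?_, ?_⟩
  · obtain ⟨y, hy, hyeq⟩ := volterra_exists (fieldG μ₁ μM B b₁ b₂ z₁ z₂) _ hL hint hlip
    have hA := solA_cadlag (b₁ := b₁) hz1 hy
    have hB := solB_cadlag (b₁ := b₁) (b₂ := b₂) hz1 hz2 hy
    have hyeq' : ∀ t, 0 ≤ t → y t = _ := fun t ht => (hyeq t ht).trans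
      (pair_integral (iiA _ _ hA hB t ht) (iiB _ hB t ht))
    refine ⟨solA b₁ z₁ y, solB b₁ b₂ z₁ z₂ y, hA.pair hB, fun t ht => ?_, fun t ht => ?_⟩
    · exact congrArg (fun c => b₁ + z₁ t - c) (congrArg Prod.fst (hyeq' t ht))
    · exact congrArg (fun c => b₂ + z₂ t + psiRefl 0 (solA b₁ z₁ y) t - c)
        (congrArg Prod.snd (hyeq' t ht))
  · have main : ∀ w₁ w₂ : ℝ → ℝ, IsTruncSol μ₁ μM B b₁ b₂ z₁ z₂ w₁ w₂ →
        ∃ y : ℝ → ℝ × ℝ, ContinuousOn y (Ici 0) ∧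
          (∀ t, 0 ≤ t → y t = ∫ s in (0:ℝ)..t, fieldG μ₁ μM B b₁ b₂ z₁ z₂ y s) ∧
          (∀ t, 0 ≤ t → solA b₁ z₁ y t = w₁ t) ∧
          (∀ t, 0 ≤ t → solB b₁ b₂ z₁ z₂ y t = w₂ t) := by
      intro w₁ w₂ hw
      refine ⟨_, hprim w₁ w₂ hw, ?_⟩
      set y : ℝ → ℝ × ℝ := fun t =>
        (∫ s in (0:ℝ)..t, (μM * phiRefl 0 w₁ s - μ₁ * phiBar B w₂ s),
        ∫ s in (0:ℝ)..t, μ₁ * phiBar B w₂ s) with hydef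
      have eA : ∀ t, 0 ≤ t → solA b₁ z₁ y t = w₁ t := fun t ht => (hw.2.1 t ht).symm
      have eB : ∀ t, 0 ≤ t → solB b₁ b₂ z₁ z₂ y t = w₂ t := by
        intro t ht
        rw [hw.2.2 t ht, ← psi_congr (κ := 0) (fun r (hr : r ∈ Icc (0:ℝ) t) => eA r hr.1)]
        rfl
      refine ⟨fun t ht => ?_, eA, eB⟩
      have : ∫ s in (0:ℝ)..t, fieldG μ₁ μM B b₁ b₂ z₁ z₂ y s =
          ∫ s in (0:ℝ)..t, (μM * phiRefl 0 w₁ s - μ₁ * phiBar B w₂ s, μ₁ * phiBar B w₂ s) := by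
        refine intervalIntegral.integral_congr fun s hs => ?_
        rw [uIcc_of_le ht] at hs
        simp only [fieldG]
        rw [phiRefl_congr hs.1 (fun r hr => eA r hr.1), phiBar_congr hs.1 (fun r hr => eB r hr.1)]
      rw [this, pair_integral (iiA _ _ hw.1.cfst hw.1.csnd t ht) (iiB _ hw.1.csnd t ht)]
    intro w₁ w₂ v₁ v₂ hw hv
    obtain ⟨y, hy, ye, yA, yB⟩ := main w₁ w₂ hw
    obtain ⟨y', hy', ye', yA', yB'⟩ := main v₁ v₂ hv
    have hu := volterra_unique (fieldG μ₁ μM B b₁ b₂ z₁ z₂) _ hL hint hlip hy hy' ye ye'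
    have uA : ∀ t, 0 ≤ t → solA b₁ z₁ y t = solA b₁ z₁ y' t := fun t ht => by
      simp only [solA, hu t ht]
    intro t ht
    refine ⟨by rw [← yA t ht, ← yA' t ht, uA t ht], ?_⟩
    rw [← yB t ht, ← yB' t ht]
    simp only [solB, hu t ht]
    rw [psi_congr (fun r (hr : r ∈ Icc (0:ℝ) t) => uA r hr.1)]
  · intro hzc w₁ w₂ hw
    have hp := hprim w₁ w₂ hw
    have c1 : ContinuousOn w₁ (Ici 0) :=
      ((continuousOn_const.add hzc.fst).sub hp.fst).congr fun t ht => hw.2.1 t ht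
    have c2 : ContinuousOn w₂ (Ici 0) :=
      (((continuousOn_const.add hzc.snd).add (psi_continuousOn c1)).sub hp.snd).congr
        fun t ht => hw.2.2 t ht
    exact c1.prodMk c2
end

section
/- Fix reals μ₁ > μ_M > 0, β > 0, a positive integer n, and κ > β/μ₁, and let Ω = (−∞,0] × [0,∞). Then there exists a function f : Ω → ℝ whose first-order partial derivatives f₁ and f₂ exist at every point of Ω, with f₁(·, x₂) absolutely continuous in the first variable for each x₂ and f₂(x₁, ·) absolutely continuous in the second variable for each x₁, such that: (a) (−β/√n − μ_M x₁ + μ₁x₂)·f₁(x) − μ₁x₂·f₂(x) = −max(x₂ − κ/√n, 0) for every x ∈ Ω; (b) f₁(0, x₂) = f₂(0, x₂) = (√n/β)·max(x₂ − κ/√n, 0) for every x₂ ≥ 0; (c) f₁(x) ≥ 0 for all x ∈ Ω, and at every point of Ω where the second-order partial derivatives f₁₁, f₁₂, f₂₂ exist, they satisfy f₁₁ ≥ 0, f₁₂ ≥ 0, f₂₂ ≥ 0; (d) at every point x ∈ Ω with 0 ≤ x₂ ≤ κ/√n where f₁₁ and f₂₂ exist, f₁₁(x) = f₂₂(x) =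 0; (e) at every point of Ω where they exist, f₁₁(x) ≤ C₅(κ)·√n and f₂₂(x) ≤ C₆(κ)·√n, where C₅(κ) = (1/β)·((μ₁+μ_M)/μ₁)·(κ/(κ − β/μ₁)) and C₆(κ) = 1/(μ₁κ) + (1/β)·(μ₁/(μ₁−μ_M))²·(κ/(κ − β/μ₁)) + (1/β)·(μ₁(1+μ_M)/(μ₁−μ_M)). -/
/-- `F` is absolutely continuous on the interval `[l, r]`. -/
def AbsolutelyContinuousOnIcc (F : ℝ → ℝ) (l r : ℝ) : Prop :=
  ∀ ε : ℝ, 0 < ε → ∃ δ : ℝ, 0 < δ ∧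
    ∀ (m : ℕ) (a b : Fin m → ℝ),
      (∀ i, l ≤ a i ∧ a i ≤ b i ∧ b i ≤ r) →
      (∀ i j, i ≠ j → Set.Ioo (a i) (b i) ∩ Set.Ioo (a j) (b j) = ∅) →
      (∑ i, (b i - a i)) < δ →
      (∑ i, |F (b i) - F (a i)|) < ε

namespace Lyap

open Real Set

def P (L s F g s' F' g' : ℝ) : Prop :=
  s ≤ s' ∧ g ≤ g' ∧ g' - g ≤ L * (s' - s) ∧ g * (s' - s) ≤ F' - F ∧ F' - F ≤ g' * (s' - s)

lemma P.trans {L s F g s' F' g' s'' F'' g'' : ℝ} (h : P L s F g s' F' g')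
    (h' : P L s' F' g' s'' F'' g'') : P L s F g s'' F'' g'' := by
  obtain ⟨a1, a2, a3, a4, a5⟩ := h
  obtain ⟨b1, b2, b3, b4, b5⟩ := h'
  refine ⟨by linarith, by linarith, by linarith, ?_, ?_⟩
  · nlinarith [mul_nonneg (sub_nonneg.2 a2) (sub_nonneg.2 b1)]
  · nlinarith [mul_nonneg (sub_nonneg.2 b2) (sub_nonneg.2 a1)]

lemma cmp {u v u' v' : ℝ → ℝ} {a b : ℝ} (hab : a ≤ b)
    (hu : ∀ t ∈ Icc a b, HasDerivAt u (u' t) t) (hv : ∀ t ∈ Icc a b, HasDerivAt v (v' t) t)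
    (h : ∀ t ∈ Icc a b, u' t ≤ v' t) : u b - u a ≤ v b - v a := by
  have hd : ∀ t ∈ Icc a b, HasDerivAt (fun t => v t - u t) (v' t - u' t) t :=
    fun t ht => (hv t ht).sub (hu t ht)
  have : MonotoneOn (fun t => v t - u t) (Icc a b) := by
    apply monotoneOn_of_deriv_nonneg (convex_Icc a b)
    · exact fun t ht => (hd t ht).continuousAt.continuousWithinAt
    · intro t ht
      exact (hd t (interior_subset ht)).differentiableAt.differentiableWithinAt
    · intro t ht
      rw [(hd t (interior_subset ht)).deriv]
      linarith [h t (interior_subset ht)]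
  have := this (left_mem_Icc.2 hab) (right_mem_Icc.2 hab) hab
  simp only at this
  linarith

lemma anti {u u' : ℝ → ℝ} {a b : ℝ} (hab : a ≤ b)
    (hu : ∀ t ∈ Icc a b, HasDerivAt u (u' t) t)
    (h : ∀ t ∈ Icc a b, u' t ≤ 0) : u b ≤ u a := by
  have := cmp (v := fun _ => 0) (v' := fun _ => 0) hab hu (fun t _ => hasDerivAt_const t 0) h
  linarith

/-- decreasing parametrised curve -/
lemma curve_desc {s F g s' g' : ℝ → ℝ} {a b L : ℝ} (hab : a ≤ b)
    (hs : ∀ t ∈ Icc a b, HasDerivAt s (s' t) t)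
    (hg : ∀ t ∈ Icc a b, HasDerivAt g (g' t) t)
    (hF : ∀ t ∈ Icc a b, HasDerivAt F (g t * s' t) t)
    (h1 : ∀ t ∈ Icc a b, s' t ≤ 0) (h2 : ∀ t ∈ Icc a b, g' t ≤ 0)
    (h3 : ∀ t ∈ Icc a b, L * s' t ≤ g' t) :
    P L (s b) (F b) (g b) (s a) (F a) (g a) := by
  have hmono : ∀ x ∈ Icc a b, ∀ y ∈ Icc a b, x ≤ y → g y ≤ g x := by
    intro x hx y hy hxy
    exact anti hxy (fun t ht => hg t ⟨hx.1.trans ht.1, ht.2.trans hy.2⟩)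
      (fun t ht => h2 t ⟨hx.1.trans ht.1, ht.2.trans hy.2⟩)
  refine ⟨anti hab hs h1, anti hab hg h2, ?_, ?_, ?_⟩
  · have := cmp hab (fun t ht => (hs t ht).const_mul L) hg h3
    linarith
  · have := cmp hab hF (fun t ht => (hs t ht).const_mul (g b)) (fun t ht => by
      have := hmono t ht b (right_mem_Icc.2 hab) ht.2
      nlinarith [h1 t ht])
    linarith
  · have := cmp hab (fun t ht => (hs t ht).const_mul (g a)) hF (fun t ht => by
      have := hmono a (left_mem_Icc.2 hab) t ht ht.1
      nlinarith [h1 t ht])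
    linarith

lemma curve_asc {s F g s' g' : ℝ → ℝ} {a b L : ℝ} (hab : a ≤ b)
    (hs : ∀ t ∈ Icc a b, HasDerivAt s (s' t) t)
    (hg : ∀ t ∈ Icc a b, HasDerivAt g (g' t) t)
    (hF : ∀ t ∈ Icc a b, HasDerivAt F (g t * s' t) t)
    (h1 : ∀ t ∈ Icc a b, 0 ≤ s' t) (h2 : ∀ t ∈ Icc a b, 0 ≤ g' t)
    (h3 : ∀ t ∈ Icc a b, g' t ≤ L * s' t) :
    P L (s a) (F a) (g a) (s b) (F b) (g b) := by
  have key : ∀ {u u' : ℝ → ℝ}, (∀ t ∈ Icc a b, HasDerivAt u (u' t) t) →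
      ∀ t ∈ Icc (-b) (-a), HasDerivAt (fun t => u (-t)) (-u' (-t)) t := by
    intro u u' hu t ht
    have := (hu (-t) ⟨by linarith [ht.2], by linarith [ht.1]⟩).comp t (hasDerivAt_neg t)
    simpa [Function.comp_def] using this
  have hm : ∀ t ∈ Icc (-b) (-a), -t ∈ Icc a b :=
    fun t ht => ⟨by linarith [ht.2], by linarith [ht.1]⟩
  have := curve_desc (a := -b) (b := -a) (L := L) (by linarith) (key hs) (key hg)
    (F := fun t => F (-t)) (fun t ht => by
      have := key hF t ht
      exact this.congr_deriv (by ring))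
    (fun t ht => by linarith [h1 _ (hm t ht)]) (fun t ht => by linarith [h2 _ (hm t ht)])
    (fun t ht => by linarith [h3 _ (hm t ht)])
  simpa using this

structure Par (m M b c : ℝ) : Prop where
  hM : 0 < M
  hm : M < m
  hb : 0 < b
  hc : b < m * c

variable {m M b c : ℝ}

lemma Par.m0 (h : Par m M b c) : 0 < m := h.hM.trans h.hm
lemma Par.d0 (h : Par m M b c) : 0 < m - M := sub_pos.2 h.hm
lemma Par.c0 (h : Par m M b c) : 0 < c := by
  have := h.hb.trans h.hc
  exact (pos_iff_pos_of_mul_pos this).1 h.m0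

noncomputable def A (M t : ℝ) : ℝ := (exp (M * t) - 1) / M
noncomputable def D (m M t : ℝ) : ℝ := m * (exp (m * t) - exp (M * t)) / (m - M)
noncomputable def R (m M t : ℝ) : ℝ := m * (exp (-(M * t)) - exp (-(m * t))) / (m - M)
noncomputable def X (m M b t y : ℝ) : ℝ := b * A M t - y * D m M t
noncomputable def phi1 (M b c t y : ℝ) : ℝ := (y - c) * exp (-(M * t)) / b
noncomputable def phi2 (m M b c t y : ℝ) : ℝ :=
  (1 - exp (-(m * t))) / m + (y - c) * (exp (-(m * t)) + R m M t) / b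
noncomputable def G (m b c t y : ℝ) : ℝ :=
  (y * exp (m * t) - y) / m - c * t + (y - c) ^ 2 / (2 * b)
noncomputable def L1 (m M b c : ℝ) : ℝ := (m + M) * c / (b * (m * c - b))
noncomputable def L2 (m M b c : ℝ) : ℝ :=
  1 / (m * c) + (m / (m - M) + (m / (m - M)) ^ 2 * (m * c / (m * c - b))) / b

lemma hexp (k t : ℝ) : HasDerivAt (fun t => exp (k * t)) (k * exp (k * t)) t := by
  have := ((hasDerivAt_id t).const_mul k).exp
  refine this.congr_deriv ?_
  simp only [id]; ring

lemma hexpn (k t : ℝ) : HasDerivAt (fun t => exp (-(k * t))) (-k * exp (-(k * t))) t := by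
  have := hexp (-k) t
  simpa only [neg_mul] using this

lemma hA (h : Par m M b c) (t : ℝ) : HasDerivAt (A M) (exp (M * t)) t := by
  have := ((hexp M t).sub_const 1).div_const M
  refine HasDerivAt.congr_deriv this ?_
  have := h.hM.ne'; field_simp

lemma hD (h : Par m M b c) (t : ℝ) :
    HasDerivAt (D m M) (m * D m M t + m * exp (M * t)) t := by
  have := (((hexp m t).sub (hexp M t)).const_mul m).div_const (m - M)
  refine HasDerivAt.congr_deriv this ?_
  have := h.d0.ne'; unfold D; field_simp; ring

lemma hR (h : Par m M b c) (t : ℝ) :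
    HasDerivAt (R m M) (m * exp (-(m * t)) - M * R m M t) t := by
  have := (((hexpn M t).sub (hexpn m t)).const_mul m).div_const (m - M)
  refine HasDerivAt.congr_deriv this ?_
  have := h.d0.ne'; unfold R; field_simp; ring

lemma D_nonneg (h : Par m M b c) {t : ℝ} (ht : 0 ≤ t) : 0 ≤ D m M t := by
  have : exp (M * t) ≤ exp (m * t) := exp_le_exp.2 (by nlinarith [h.hm])
  have := h.m0; have := h.d0
  unfold D
  exact div_nonneg (mul_nonneg h.m0.le (by linarith)) h.d0.le

lemma D_pos (h : Par m M b c) {t : ℝ} (ht : 0 < t) : 0 < D m M t := by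
  have : exp (M * t) < exp (m * t) := exp_lt_exp.2 (by nlinarith [h.hm])
  unfold D
  exact div_pos (mul_pos h.m0 (by linarith)) h.d0

lemma R_eq (t : ℝ) : R m M t = exp (-(m * t)) * exp (-(M * t)) * D m M t := by
  have e1 : exp (-(m * t)) * exp (m * t) = 1 := by rw [← exp_add]; simp
  have e2 : exp (-(M * t)) * exp (M * t) = 1 := by rw [← exp_add]; simp
  unfold R D
  rw [mul_div_assoc', mul_sub, mul_sub, mul_sub]
  congr 1
  linear_combination (-m * exp (-(M * t))) * e1 + (m * exp (-(m * t))) * e2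

lemma R_nonneg (h : Par m M b c) {t : ℝ} (ht : 0 ≤ t) : 0 ≤ R m M t := by
  rw [R_eq]; have := D_nonneg h ht; positivity

lemma S_le (h : Par m M b c) {t : ℝ} (ht : 0 ≤ t) : exp (-(m * t)) + R m M t ≤ 1 := by
  have := anti (u := fun t => exp (-(m * t)) + R m M t) ht
    (fun s _ => (hexpn m s).add (hR h s)) (fun s hs => by
      have := mul_nonneg h.hM.le (R_nonneg h hs.1); linarith)
  simpa [R] using this

lemma hH (h : Par m M b c) (t : ℝ) : HasDerivAt (fun t => X m M b t c)
    (b * exp (M * t) - c * (m * D m M t + m * exp (M * t))) t :=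
  ((hA h t).const_mul b).sub ((hD h t).const_mul c)

lemma H_deriv_le (h : Par m M b c) {t : ℝ} (ht : 0 ≤ t) :
    b * exp (M * t) - c * (m * D m M t + m * exp (M * t)) ≤ -(m * c - b) := by
  have h1 : 1 ≤ exp (M * t) := one_le_exp (mul_nonneg h.hM.le ht)
  have h2 := mul_nonneg (mul_nonneg h.c0.le h.m0.le) (D_nonneg h ht)
  nlinarith [h.hc]

lemma H_le (h : Par m M b c) {t t' : ℝ} (ht : 0 ≤ t) (htt : t ≤ t') :
    X m M b t' c ≤ X m M b t c - (m * c - b) * (t' - t) := by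
  have := cmp htt (fun s _ => hH h s) (v := fun s => -(m * c - b) * s) (v' := fun s => -(m * c - b))
    (fun s _ => by simpa using (hasDerivAt_id s).const_mul (-(m * c - b)))
    (fun s hs => H_deriv_le h (ht.trans hs.1))
  linarith

lemma X_le_H (h : Par m M b c) {t y : ℝ} (ht : 0 ≤ t) (hy : c ≤ y) : X m M b t y ≤ X m M b t c := by
  unfold X; nlinarith [D_nonneg h ht]

@[simp] lemma X_zero (y : ℝ) : X m M b 0 y = 0 := by simp [X, A, D]

/-- `x₁` coordinate with `x₂` fixed -/
lemma hv (h : Par m M b c) (z t : ℝ) :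
    HasDerivAt (fun t => X m M b t (z * exp (-(m * t))))
      (exp (M * t) * (b - m * (z * exp (-(m * t))))) t := by
  have := ((hA h t).const_mul b).sub (((hexpn m t).const_mul z).mul (hD h t))
  refine HasDerivAt.congr_deriv this ?_
  ring

lemma hphi1 (z t : ℝ) :
    HasDerivAt (fun t => phi1 M b c t (z * exp (-(m * t))))
      (-(exp (-(M * t)) * (m * (z * exp (-(m * t))) + M * (z * exp (-(m * t)) - c)) / b)) t := by
  have := ((((hexpn m t).const_mul z).sub_const c).mul (hexpn M t)).div_const b
  refine HasDerivAt.congr_deriv this ?_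
  ring

lemma G_slice (z t : ℝ) : G m b c t (z * exp (-(m * t))) =
    (z - z * exp (-(m * t))) / m - c * t + (z * exp (-(m * t)) - c) ^ 2 / (2 * b) := by
  have e1 : exp (-(m * t)) * exp (m * t) = 1 := by rw [← exp_add]; simp
  unfold G; rw [mul_assoc, e1, mul_one]

lemma hG1 (h : Par m M b c) (z t : ℝ) :
    HasDerivAt (fun t => G m b c t (z * exp (-(m * t))))
      (phi1 M b c t (z * exp (-(m * t))) * (exp (M * t) * (b - m * (z * exp (-(m * t)))))) t := by
  simp only [G_slice]
  have h1 := (hexpn m t).const_mul z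
  have := (((h1.const_sub z).div_const m).sub ((hasDerivAt_id t).const_mul c)).add
    (((h1.sub_const c).pow 2).div_const (2 * b))
  refine HasDerivAt.congr_deriv this ?_
  have e2 : exp (-(M * t)) * exp (M * t) = 1 := by rw [← exp_add]; simp
  have := h.m0.ne'; have := h.hb.ne'
  unfold phi1
  rw [show ∀ a q b k B : ℝ, a * q / b * (k * B) = (q * k) * (a * B / b) by intros; ring, e2]
  simp
  field_simp; ring

structure Rel (m M b c x1 x2 t y : ℝ) : Prop where
  ht : 0 ≤ t
  hy : c ≤ y
  h2 : x2 = y * exp (m * t)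
  h1 : x1 ≤ X m M b t y
  hor : x1 = X m M b t y ∨ y = c

lemma Rel.y_eq {x1 x2 t y : ℝ} (r : Rel m M b c x1 x2 t y) : y = x2 * exp (-(m * t)) := by
  rw [r.h2, mul_assoc, ← exp_add]; simp

lemma L1_bound (h : Par m M b c) {y t : ℝ} (ht : 0 ≤ t) (hy : c ≤ y) :
    L1 m M b c * (exp (M * t) * (b - m * y)) ≤ -(exp (-(M * t)) * (m * y + M * (y - c)) / b) := by
  have k0 : 0 < m * c - b := sub_pos.2 h.hc
  have h1 : 1 ≤ exp (M * t) := one_le_exp (mul_nonneg h.hM.le ht)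
  have h2 : exp (-(M * t)) ≤ 1 := exp_le_one_iff.2 (by nlinarith [h.hM])
  have hb := h.hb; have hc := h.c0; have hm := h.m0; have hM := h.hM
  have hyb : 0 < m * y - b := by nlinarith
  have a1 : (m * y + M * (y - c)) ≤ (m + M) * c / (m * c - b) * (m * y - b) := by
    rw [div_mul_eq_mul_div, le_div_iff₀ k0]
    have : y * (m * c - b) ≤ c * (m * y - b) := by nlinarith
    have e : 0 ≤ M * c * (m * c - b) := by positivity
    nlinarith [mul_le_mul_of_nonneg_left this (add_pos hm hM).le]
  have a2 : 0 ≤ m * y + M * (y - c) := by nlinarith [mul_nonneg hM.le (sub_nonneg.2 hy)]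
  have a3 : exp (-(M * t)) * (m * y + M * (y - c)) ≤
     exp (M * t) * ((m + M) * c / (m * c - b) * (m * y - b)) := by
    calc _ ≤ 1 * (m * y + M * (y - c)) := by gcongr
      _ ≤ exp (M * t) * _ := by gcongr; 
  have : L1 m M b c = (m + M) * c / (m * c - b) / b := by unfold L1; field_simp
  rw [this]
  have := div_le_div_of_nonneg_right a3 hb.le
  rw [← sub_nonneg] at this ⊢
  refine this.trans_eq ?_
  ring

lemma slice1_pre (h : Par m M b c) {z t t' : ℝ} (ht' : 0 ≤ t') (htt : t' ≤ t)
    (hc : c ≤ z * exp (-(m * t))) (hz : 0 ≤ z) :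
    P (L1 m M b c) (X m M b t (z * exp (-(m * t)))) (G m b c t (z * exp (-(m * t))))
      (phi1 M b c t (z * exp (-(m * t))))
      (X m M b t' (z * exp (-(m * t')))) (G m b c t' (z * exp (-(m * t'))))
      (phi1 M b c t' (z * exp (-(m * t')))) := by
  have hy : ∀ s ∈ Icc t' t, c ≤ z * exp (-(m * s)) := by
    intro s hs
    refine hc.trans ?_
    have : exp (-(m * t)) ≤ exp (-(m * s)) := exp_le_exp.2 (by nlinarith [h.m0, hs.2])
    gcongr
  refine curve_desc htt (fun s _ => hv h z s) (fun s _ => hphi1 z s) (fun s _ => hG1 h z s)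
    ?_ ?_ ?_
  · intro s hs
    have := hy s hs
    have e : b - m * (z * exp (-(m * s))) ≤ 0 := by nlinarith [h.m0, h.hc]
    exact mul_nonpos_of_nonneg_of_nonpos (exp_pos _).le e
  · intro s hs
    have := hy s hs
    have := h.c0; have := h.m0; have := h.hM; have := h.hb
    have : 0 ≤ m * (z * exp (-(m * s))) + M * (z * exp (-(m * s)) - c) :=
      add_nonneg (by positivity) (mul_nonneg h.hM.le (by linarith))
    have : 0 ≤ (exp (-(M * s)) * (m * (z * exp (-(m * s))) + M * (z * exp (-(m * s)) - c)) / b) := by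
      positivity
    linarith
  · intro s hs
    exact L1_bound h (ht'.trans hs.1) (hy s hs)

lemma slice1 (h : Par m M b c) {z s s' t y t' y' : ℝ} (r : Rel m M b c s z t y)
    (r' : Rel m M b c s' z t' y') (hs : s ≤ s') :
    P (L1 m M b c) s (G m b c t y) (phi1 M b c t y) s' (G m b c t' y') (phi1 M b c t' y') := by
  have hz : 0 ≤ z := by rw [r.h2]; have := h.c0.trans_le r.hy; positivity
  have hz0 : 0 < z := by rw [r.h2]; have := h.c0.trans_le r.hy; positivity
  have L0 : 0 ≤ L1 m M b c := by
    have := h.c0; have := h.m0; have := h.hM; have := h.hb; have := sub_pos.2 h.hc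
    unfold L1; positivity
  have f0 : ∀ {t y}, c ≤ y → 0 ≤ phi1 M b c t y := by
    intro t y hy
    have := sub_nonneg.2 hy; have := h.hb
    unfold phi1; positivity
  have ey := r.y_eq
  have ey' := r'.y_eq
  have hc := r.hy
  have hc' := r'.hy
  rcases le_or_gt t' t with htt | htt
  · have := slice1_pre h r'.ht htt (ey ▸ hc) hz
    rw [← ey, ← ey'] at this
    obtain ⟨a1, a2, a3, a4, a5⟩ := this
    have g' := f0 (t := t') hc'
    have g := f0 (t := t) hc
    have k : X m M b t' y' - X m M b t y ≤ s' - s ∨ y' = c := by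
      rcases r'.hor with e | e
      · left; linarith [r.h1]
      · right; exact e
    have kk : y' = c → t = t' ∧ y = c := by
      intro e
      have : y = y' := by
        have : y ≤ y' := by
          rw [ey, ey']
          have : exp (-(m * t)) ≤ exp (-(m * t')) := exp_le_exp.2 (by nlinarith [h.m0])
          gcongr
        linarith
      refine ⟨?_, by linarith⟩
      have e2 : exp (-(m * t)) = exp (-(m * t')) := by
        rw [ey, ey'] at this; exact mul_left_cancel₀ hz0.ne' this
      have := exp_injective e2
      exact mul_left_cancel₀ h.m0.ne' (by linarith)
    rcases k with k | k
    · refine ⟨hs, a2, a3.trans (by gcongr), ?_, a5.trans (by gcongr)⟩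
      rcases r.hor with e | e
      · rcases r'.hor with e' | e'
        · rw [e, e']; exact a4
        · obtain ⟨u, v⟩ := kk e'
          simp [phi1, v, u, e']
      · have : phi1 M b c t y = 0 := by simp [phi1, e]
        rw [this] at a4 ⊢; simpa using a4
    · obtain ⟨u, v⟩ := kk k
      subst u; rw [k, v]
      have e0 : phi1 M b c t c = 0 := by simp [phi1]
      refine ⟨hs, le_rfl, ?_, ?_, ?_⟩ <;> simp [e0]
      have := sub_nonneg.2 hs; positivity
  · have := slice1_pre h r.ht htt.le (ey' ▸ hc') hz
    rw [← ey, ← ey'] at this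
    have hyy : y' < y := by
      rw [ey, ey']
      have : exp (-(m * t')) < exp (-(m * t)) := exp_lt_exp.2 (by nlinarith [h.m0])
      gcongr
    have e : s = X m M b t y := r.hor.resolve_right (by linarith)
    -- then everything is equal
    have e3 : X m M b t' y' = X m M b t y := le_antisymm this.1 (by linarith [r'.h1])
    have e4 : s' = s := le_antisymm (by linarith [r'.h1]) hs
    obtain ⟨a1, a2, a3, a4, a5⟩ := this
    rw [e3] at a3 a4 a5
    simp only [sub_self, mul_zero] at a3 a4 a5
    subst e4
    refine ⟨le_rfl, by linarith, ?_, ?_, ?_⟩ <;> simp only [sub_self, mul_zero] <;> linarith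


lemma bb_alg1 (h : Par m M b c) {p r W z : ℝ} (hp : 0 < p) (hr : 0 < r)
    (hW : c ≤ W) (hz : z * r = b - m * W) :
    z ≤ 0 ∧ p + ((z * p - m * W) * (p + r) - (W - c) * (M * r)) / b ≤ 0 := by
  have hb := h.hb; have hc := h.c0; have hm := h.m0; have hM := h.hM; have hcb := h.hc
  have hyb : 0 < m * W - b := by nlinarith
  have hz0 : z ≤ 0 := by
    by_contra hh
    push Not at hh
    nlinarith [mul_pos hh hr]
  refine ⟨hz0, ?_⟩
  have e : p + ((z * p - m * W) * (p + r) - (W - c) * (M * r)) / b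
    = (p * b + ((z * p - m * W) * (p + r) - (W - c) * (M * r))) / b := by field_simp
  rw [e]
  apply div_nonpos_of_nonpos_of_nonneg _ hb.le
  have a1 : z * p * (p + r) ≤ 0 := mul_nonpos_of_nonpos_of_nonneg
    (mul_nonpos_of_nonpos_of_nonneg hz0 hp.le) (by positivity)
  have a2 : 0 ≤ (W - c) * (M * r) := mul_nonneg (by linarith) (by positivity)
  have a3 : p * b ≤ m * W * (p + r) := by nlinarith
  nlinarith

lemma bb_alg2 (h : Par m M b c) {p r W z : ℝ} (hp : 0 < p) (hr : 0 < r) (hS : p + r ≤ 1)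
    (hW : c ≤ W) (hz : z * r = b - m * W) :
    L2 m M b c * z ≤ p + ((z * p - m * W) * (p + r) - (W - c) * (M * r)) / b := by
  have hb := h.hb; have hc := h.c0; have hm := h.m0; have hM := h.hM; have hcb := h.hc
  have hd := h.d0
  have k0 : 0 < m * c - b := sub_pos.2 h.hc
  have hyb : 0 < m * W - b := by nlinarith
  have hz0 := (bb_alg1 h hp hr hW hz).1
  have hW0 : 0 < W := by linarith
  set ρ := m / (m - M) with hρ
  have hρ1 : 1 ≤ ρ := by rw [hρ, le_div_iff₀ hd]; linarith
  have hρ2 : m + M ≤ ρ ^ 2 * m := by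
    rw [hρ, div_pow, div_mul_eq_mul_div, le_div_iff₀ (by positivity)]
    nlinarith [mul_pos hM hm, mul_pos (mul_pos hM hM) hd, mul_pos (mul_pos hM hm) hm]
  -- main estimate
  have key : (m * W * (p + r) + (W - c) * (M * r)) * r ≤
      ρ ^ 2 * (m * c / (m * c - b)) * (m * W - b) := by
    have b1 : (m * W * (p + r) + (W - c) * (M * r)) * r ≤ (m + M) * W := by
      have hr1 : r ≤ 1 := by linarith
      have c1 : m * W * (p + r) ≤ m * W * 1 := by gcongr
      have c2 : (W - c) * (M * r) ≤ W * (M * 1) := by gcongr; linarith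
      have c3 : 0 ≤ m * W * (p + r) + (W - c) * (M * r) :=
        add_nonneg (by positivity) (mul_nonneg (by linarith) (by positivity))
      nlinarith
    have b2 : W ≤ c / (m * c - b) * (m * W - b) := by
      rw [div_mul_eq_mul_div, le_div_iff₀ k0]; nlinarith
    calc _ ≤ (m + M) * W := b1
      _ ≤ (ρ ^ 2 * m) * (c / (m * c - b) * (m * W - b)) := by gcongr
      _ = _ := by ring
  have key2 : (m * W * (p + r) + (W - c) * (M * r)) ≤ ρ ^ 2 * (m * c / (m * c - b)) * (-z) := by
    have : (m * W * (p + r) + (W - c) * (M * r)) * r ≤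
      (ρ ^ 2 * (m * c / (m * c - b)) * (-z)) * r := by
      refine key.trans_eq ?_
      linear_combination (ρ ^ 2 * (m * c / (m * c - b))) * hz
    exact le_of_mul_le_mul_right this hr
  have key3 : p * (p + r) * (-z) ≤ ρ * (-z) := by
    have : p * (p + r) ≤ ρ := by nlinarith
    have := neg_nonneg.2 hz0
    gcongr
  have key4 : 1 / (m * c) * z ≤ 0 := mul_nonpos_of_nonneg_of_nonpos (by positivity) hz0
  have key5 : (ρ + ρ ^ 2 * (m * c / (m * c - b))) * z ≤
    (z * p - m * W) * (p + r) - (W - c) * (M * r) := by linarith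
  have := div_le_div_of_nonneg_right key5 hb.le
  unfold L2
  rw [← hρ, add_mul, div_mul_eq_mul_div (ρ + _)]
  linarith

lemma bb (h : Par m M b c) {x s s' t y t' y' : ℝ} (r : Rel m M b c x s t y)
    (r' : Rel m M b c x s' t' y') (e : x = X m M b t y) (e' : x = X m M b t' y')
    (ht' : 0 < t') (htt : t' ≤ t) :
    P (L2 m M b c) s (G m b c t y) (phi2 m M b c t y) s' (G m b c t' y') (phi2 m M b c t' y') := by
  obtain ⟨W, hWdef⟩ : ∃ W : ℝ → ℝ, W = fun t => (b * A M t - x) / D m M t := ⟨_, rfl⟩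
  have wy : W t = y := by
    have := D_pos h (ht'.trans_le htt)
    simp only [hWdef, e, X]; field_simp; ring
  have wy' : W t' = y' := by
    have := D_pos h ht'
    simp only [hWdef, e', X]; field_simp; ring
  have wc : ∀ u ∈ Icc t' t, c ≤ W u := by
    intro u hu
    have u0 : 0 < u := ht'.trans_le hu.1
    rw [hWdef, le_div_iff₀ (D_pos h u0)]
    have h1 := H_le h u0.le hu.2
    have h2 := X_le_H h r.ht r.hy
    have h3 : 0 ≤ (m * c - b) * (t - u) := mul_nonneg (sub_nonneg.2 h.hc.le) (sub_nonneg.2 hu.2)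
    have : x ≤ X m M b u c := by linarith
    unfold X at this; linarith
  obtain ⟨z, hzdef⟩ : ∃ z : ℝ → ℝ, z = fun u => exp (M * u) * exp (m * u) * (b - m * W u) / D m M u :=
    ⟨_, rfl⟩
  have hz : ∀ u ∈ Icc t' t, z u * R m M u = b - m * W u := by
    intro u hu
    have u0 : 0 < u := ht'.trans_le hu.1
    have := D_pos h u0
    have e1 : exp (-(m * u)) * exp (m * u) = 1 := by rw [← exp_add]; simp
    have e2 : exp (-(M * u)) * exp (M * u) = 1 := by rw [← exp_add]; simp
    rw [R_eq, hzdef]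
    simp only
    generalize exp (-(m * u)) = p at *
    generalize exp (-(M * u)) = q at *
    generalize exp (m * u) = p' at *
    generalize exp (M * u) = q' at *
    field_simp
    linear_combination (b - m * W u) * q * q' * e1 + (b - m * W u) * e2
  have hW : ∀ u ∈ Icc t' t, HasDerivAt W (z u * exp (-(m * u)) - m * W u) u := by
    intro u hu
    have u0 : 0 < u := ht'.trans_le hu.1
    have hD0 := (D_pos h u0).ne'
    have e1 : exp (-(m * u)) * exp (m * u) = 1 := by rw [← exp_add]; simp
    have := (((hA h u).const_mul b).sub_const x).div (hD h u) hD0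
    rw [hWdef]
    refine HasDerivAt.congr_deriv this ?_
    rw [← hWdef]
    have hw : b * A M u - x = W u * D m M u := by rw [hWdef]; field_simp
    rw [hw, hzdef]
    simp only
    clear this hw
    generalize exp (-(m * u)) = p at *
    generalize exp (m * u) = p' at *
    field_simp
    linear_combination (-(exp (M * u) * (b - m * W u))) * e1
  have hY : ∀ u ∈ Icc t' t, HasDerivAt (fun u => W u * exp (m * u)) (z u) u := by
    intro u hu
    have e1 : exp (-(m * u)) * exp (m * u) = 1 := by rw [← exp_add]; simp
    refine HasDerivAt.congr_deriv ((hW u hu).mul (hexp m u)) ?_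
    linear_combination z u * e1
  have hm0 := h.m0.ne'
  have hb0 := h.hb.ne'
  have hphi : ∀ u ∈ Icc t' t, HasDerivAt (fun u => phi2 m M b c u (W u))
      (exp (-(m * u)) + ((z u * exp (-(m * u)) - m * W u) * (exp (-(m * u)) + R m M u)
        - (W u - c) * (M * R m M u)) / b) u := by
    intro u hu
    have := (((hexpn m u).const_sub 1).div_const m).add
      ((((hW u hu).sub_const c).mul ((hexpn m u).add (hR h u))).div_const b)
    refine HasDerivAt.congr_deriv this ?_
    simp only [Pi.add_apply]
    field_simp; ring
  have hG : ∀ u ∈ Icc t' t, HasDerivAt (fun u => G m b c u (W u))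
      (phi2 m M b c u (W u) * z u) u := by
    intro u hu
    have := ((((hY u hu).sub (hW u hu)).div_const m).sub ((hasDerivAt_id u).const_mul c)).add
      ((((hW u hu).sub_const c).pow 2).div_const (2 * b))
    refine HasDerivAt.congr_deriv this ?_
    have hz' := hz u hu
    simp only [phi2]
    simp
    clear this
    generalize exp (-(m * u)) = p at *
    field_simp
    linear_combination (-m * (W u - c)) * hz'
  have hr : ∀ u ∈ Icc t' t, 0 < R m M u := by
    intro u hu
    have := D_pos h (ht'.trans_le hu.1)
    rw [R_eq]; positivity
  have := curve_desc (L := L2 m M b c) htt hY hphi hG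
    (fun u hu => (bb_alg1 h (exp_pos (-(m * u))) (hr u hu) (wc u hu) (hz u hu)).1)
    (fun u hu => (bb_alg1 h (exp_pos (-(m * u))) (hr u hu) (wc u hu) (hz u hu)).2)
    (fun u hu => bb_alg2 h (exp_pos _) (hr u hu) (S_le h (ht'.le.trans hu.1)) (wc u hu) (hz u hu))
  simp only [wy, wy'] at this
  rwa [← r.h2, ← r'.h2] at this

lemma L2_ge (h : Par m M b c) : 1 / (m * c) ≤ L2 m M b c ∧ 1 / b ≤ L2 m M b c := by
  have hb := h.hb; have hc := h.c0; have hm := h.m0; have hM := h.hM; have hcb := h.hc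
  have hd := h.d0
  have k0 : 0 < m * c - b := sub_pos.2 h.hc
  have hρ1 : 1 ≤ m / (m - M) := by rw [le_div_iff₀ hd]; linarith
  have : 0 ≤ (m / (m - M)) ^ 2 * (m * c / (m * c - b)) := by positivity
  have a : 1 / b ≤ (m / (m - M) + (m / (m - M)) ^ 2 * (m * c / (m * c - b))) / b := by
    gcongr; linarith
  have a' : 0 < 1 / b := by positivity
  have a'' : 0 < 1 / (m * c) := by positivity
  unfold L2
  constructor <;> linarith

lemma aa (h : Par m M b c) {t t' : ℝ} (htt : t ≤ t') :
    P (L2 m M b c) (c * exp (m * t)) (G m b c t c) (phi2 m M b c t c)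
      (c * exp (m * t')) (G m b c t' c) (phi2 m M b c t' c) ∨ t < 0 := by
  rcases lt_or_ge t 0 with h0 | h0
  · exact Or.inr h0
  left
  have hc := h.c0; have hm := h.m0
  have hphi : ∀ u, phi2 m M b c u c = (1 - exp (-(m * u))) / m := by intro u; simp [phi2]
  have hGG : ∀ u, G m b c u c = (c * exp (m * u) - c) / m - c * u := by intro u; simp [G]
  have := curve_asc (L := L2 m M b c) (s := fun u => c * exp (m * u))
    (F := fun u => G m b c u c) (g := fun u => phi2 m M b c u c) (g' := fun u => exp (-(m * u)))
    htt (fun u _ => (hexp m u).const_mul c) ?_ ?_ ?_ ?_ ?_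
  · exact this
  · intro u _
    simp only [hphi]
    refine HasDerivAt.congr_deriv (((hexpn m u).const_sub 1).div_const m) ?_
    field_simp
  · intro u _
    simp only [hGG, hphi]
    have := ((((hexp m u).const_mul c).sub_const c).div_const m).sub
      ((hasDerivAt_id u).const_mul c)
    refine HasDerivAt.congr_deriv this ?_
    have e1 : exp (-(m * u)) * exp (m * u) = 1 := by rw [← exp_add]; simp
    clear this
    generalize exp (-(m * u)) = p at *
    generalize exp (m * u) = p' at *
    field_simp
    linear_combination e1
  · intro u _; positivity
  · intro u _; positivity
  · intro u hu
    have u0 : 0 ≤ m * u := mul_nonneg hm.le (h0.trans hu.1)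
    calc exp (-(m * u)) ≤ 1 := exp_le_one_iff.2 (by linarith)
      _ ≤ exp (m * u) := one_le_exp u0
      _ = 1 / (m * c) * (c * (m * exp (m * u))) := by field_simp
      _ ≤ _ := by gcongr; exact (L2_ge h).1

lemma X_neg (h : Par m M b c) {t y : ℝ} (ht : 0 < t) (hy : c ≤ y) : X m M b t y < 0 := by
  have h1 := H_le h le_rfl ht.le
  have h2 := X_le_H h ht.le hy
  have := mul_pos (sub_pos.2 h.hc) ht
  simp at h1
  linarith

lemma Rel.t_zero (h : Par m M b c) {s t y : ℝ} (r : Rel m M b c 0 s t y) : t = 0 ∧ y = s := by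
  have : t = 0 := by
    by_contra hne
    have := X_neg h (lt_of_le_of_ne r.ht (Ne.symm hne)) r.hy
    linarith [r.h1]
  refine ⟨this, ?_⟩
  have := r.h2
  simp_all

lemma exists_tbar (h : Par m M b c) {x t : ℝ} (ht : 0 ≤ t) (hx : x ≤ X m M b t c) :
    ∃ T, t ≤ T ∧ x = X m M b T c := by
  have k0 : 0 < m * c - b := sub_pos.2 h.hc
  set u := t + (X m M b t c - x) / (m * c - b) with hu
  have htu : t ≤ u := by
    have : 0 ≤ (X m M b t c - x) / (m * c - b) := div_nonneg (by linarith) k0.le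
    linarith
  have h1 := H_le h ht htu
  have h2 : (m * c - b) * (u - t) = X m M b t c - x := by rw [hu]; field_simp; ring
  have hcont : ContinuousOn (fun t => X m M b t c) (Icc t u) :=
    fun v _ => (hH h v).continuousAt.continuousWithinAt
  obtain ⟨T, hT, e⟩ := intermediate_value_Icc' htu hcont (show x ∈ _ from ⟨by linarith, hx⟩)
  exact ⟨T, hT.1, e.symm⟩

lemma H_inj (h : Par m M b c) {t t' : ℝ} (ht : 0 ≤ t)
    (hx : X m M b t c ≤ X m M b t' c) : t' ≤ t := by
  by_contra hlt
  push Not at hlt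
  have := H_le h ht hlt.le
  have := mul_pos (sub_pos.2 h.hc) (sub_pos.2 hlt)
  linarith

lemma Rel.pos {x t y : ℝ} (hx : x < 0) (e : x = X m M b t y) (ht : 0 ≤ t) : 0 < t := by
  rcases ht.eq_or_lt with h0 | h0
  · subst h0; simp at e; linarith
  · exact h0

/-- Two strict cases: order of times on the level set -/
lemma bb_order (h : Par m M b c) {x s s' t y t' y' : ℝ} (hx : x < 0) (r : Rel m M b c x s t y)
    (r' : Rel m M b c x s' t' y') (e : x = X m M b t y) (e' : x = X m M b t' y')
    (hs : s < s') : t' ≤ t := by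
  by_contra hlt
  push Not at hlt
  have := (bb h r' r e' e (Rel.pos hx e r.ht) hlt.le).1
  linarith

lemma ba_imposs (h : Par m M b c) {x s s' t y t' y' : ℝ} (hx : x < 0) (r : Rel m M b c x s t y)
    (r' : Rel m M b c x s' t' y') (hy : y ≠ c) (hs : s < s') : x = X m M b t' y' := by
  have e := r.hor.resolve_right hy
  rcases r'.hor with e' | e'
  · exact e'
  · have k := r'.h1
    have k2 := r'.h2
    rw [e'] at k k2
    obtain ⟨T, hT, eT⟩ := exists_tbar h r'.ht k
    have hT0 := r'.ht.trans hT
    have rT : Rel m M b c x (c * exp (m * T)) T c := ⟨hT0, le_rfl, rfl, eT.le, Or.inl eT⟩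
    have hsT : s' ≤ c * exp (m * T) := by
      rw [k2]
      have := h.c0
      have : exp (m * t') ≤ exp (m * T) := exp_le_exp.2 (by nlinarith [h.m0])
      gcongr
    have o := bb_order h hx r rT e eT (hs.trans_le hsT)
    have o2 : t ≤ T := H_inj h hT0 (by
      rw [← eT, e]; exact X_le_H h r.ht r.hy)
    have : t = T := le_antisymm o2 o
    exfalso
    subst this
    have hyc := lt_of_le_of_ne r.hy (Ne.symm hy)
    have := D_pos h (Rel.pos hx e r.ht)
    have e2 := e.symm.trans eT
    unfold X at e2
    nlinarith

lemma slice2 (h : Par m M b c) {x s s' t y t' y' : ℝ} (hx : x ≤ 0) (r : Rel m M b c x s t y)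
    (r' : Rel m M b c x s' t' y') (hs : s < s') :
    P (L2 m M b c) s (G m b c t y) (phi2 m M b c t y) s' (G m b c t' y') (phi2 m M b c t' y') := by
  rcases hx.eq_or_lt with hx | hx
  · subst hx
    obtain ⟨rfl, rfl⟩ := r.t_zero h
    obtain ⟨rfl, rfl⟩ := r'.t_zero h
    have hb := h.hb
    have hc := r.hy
    have hL := (L2_ge h).2
    have p0 : ∀ z, phi2 m M b c 0 z = (z - c) / b := by intro z; simp [phi2, R]
    have g0 : ∀ z, G m b c 0 z = (z - c) ^ 2 / (2 * b) := by intro z; simp [G]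
    rw [p0, p0, g0, g0]
    have hs0 := sub_pos.2 hs
    refine ⟨hs.le, by gcongr, ?_, ?_, ?_⟩
    · calc _ = 1 / b * (y' - y) := by ring
        _ ≤ _ := by gcongr
    · rw [← sub_nonneg]
      have : (y' - c) ^ 2 / (2 * b) - (y - c) ^ 2 / (2 * b) - (y - c) / b * (y' - y)
        = (y' - y) ^ 2 / (2 * b) := by field_simp; ring
      rw [this]; positivity
    · rw [← sub_nonneg]
      have : (y' - c) / b * (y' - y) - ((y' - c) ^ 2 / (2 * b) - (y - c) ^ 2 / (2 * b))
        = (y' - y) ^ 2 / (2 * b) := by field_simp; ring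
      rw [this]; positivity
  by_cases hy : y = c
  · -- start in A
    have k := r.h1
    have k2 := r.h2
    subst hy
    rcases r'.hor with e' | e'
    · obtain ⟨T, hT, eT⟩ := exists_tbar h r.ht k
      have hT0 := r.ht.trans hT
      have rT : Rel m M b y x (y * exp (m * T)) T y := ⟨hT0, le_rfl, rfl, eT.le, Or.inl eT⟩
      have p1 := (aa h hT).resolve_right (not_lt.2 r.ht)
      rw [← k2] at p1
      refine p1.trans (bb h rT r' eT e' (Rel.pos hx e' r'.ht) ?_)
      apply H_inj h hT0
      rw [← eT, e']
      exact X_le_H h r'.ht r'.hy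
    · have k2' := r'.h2
      rw [e'] at k2' ⊢
      have : t ≤ t' := by
        by_contra hlt
        push Not at hlt
        have : exp (m * t') ≤ exp (m * t) := exp_le_exp.2 (by nlinarith [h.m0])
        have := mul_le_mul_of_nonneg_left this h.c0.le
        linarith
      have p1 := (aa h this).resolve_right (not_lt.2 r.ht)
      rwa [← k2, ← k2'] at p1
  · have e := r.hor.resolve_right hy
    have e' := ba_imposs h hx r r' hy hs
    exact bb h r r' e e' (Rel.pos hx e' r'.ht) (bb_order h hx r r' e e' hs)

lemma phi1_nonneg (h : Par m M b c) {t y : ℝ} (hy : c ≤ y) : 0 ≤ phi1 M b c t y := by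
  have := sub_nonneg.2 hy; have := h.hb
  unfold phi1; positivity

lemma slice12 (h : Par m M b c) {x s s' t y t' y' : ℝ} (hx : x ≤ 0) (r : Rel m M b c x s t y)
    (r' : Rel m M b c x s' t' y') (hs : s < s') : phi1 M b c t y ≤ phi1 M b c t' y' := by
  by_cases hy : y = c
  · have : phi1 M b c t y = 0 := by simp [phi1, hy]
    rw [this]; exact phi1_nonneg h r'.hy
  have htt : t' ≤ t := by
    rcases hx.eq_or_lt with hx | hx
    · subst hx
      rw [(r.t_zero h).1, (r'.t_zero h).1]
    · exact bb_order h hx r r' (r.hor.resolve_right hy) (ba_imposs h hx r r' hy hs) hs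
  have s0 : 0 < s := by rw [r.h2]; have := h.c0.trans_le r.hy; positivity
  have e1 : exp (-(m * t)) ≤ exp (-(m * t')) := exp_le_exp.2 (by nlinarith [h.m0])
  have e2 : exp (-(M * t)) ≤ exp (-(M * t')) := exp_le_exp.2 (by nlinarith [h.hM])
  have yy : y ≤ y' := by
    rw [r.y_eq, r'.y_eq]
    have := s0.trans hs
    gcongr
  have := h.hb
  have := sub_nonneg.2 r.hy
  unfold phi1
  gcongr
  exact sub_nonneg.2 (r.hy.trans yy)

lemma pde (h : Par m M b c) {x s t y : ℝ} (r : Rel m M b c x s t y) :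
    (-b - M * x + m * s) * phi1 M b c t y - m * s * phi2 m M b c t y = -(s - c) := by
  have hb := h.hb.ne'; have hm := h.m0.ne'; have hM := h.hM.ne'; have hd := h.d0.ne'
  have e1 : exp (-(m * t)) * exp (m * t) = 1 := by rw [← exp_add]; simp
  have e2 : exp (-(M * t)) * exp (M * t) = 1 := by rw [← exp_add]; simp
  have h2 := r.h2
  by_cases hy : y = c
  · subst hy
    simp only [phi1, phi2, h2]
    field_simp
    linear_combination y * b * e1
  · rw [r.hor.resolve_right hy]
    simp only [phi1, phi2, h2, X, A, D, R]
    rw [exp_neg, exp_neg]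
    field_simp
    ring

lemma exists_rel (h : Par m M b c) {x s : ℝ} (hx : x ≤ 0) (hs : c < s) :
    ∃ t y, Rel m M b c x s t y := by
  have hc := h.c0
  have hm := h.m0
  set T := log (s / c) / m with hT
  have eT : exp (m * T) = s / c := by
    rw [hT, mul_div_cancel₀ _ hm.ne', exp_log (by have := hc.trans hs; positivity)]
  have T0 : 0 ≤ T := div_nonneg (log_nonneg (by rw [le_div_iff₀ hc]; linarith)) hm.le
  have sT : s = c * exp (m * T) := by rw [eT]; field_simp
  rcases le_or_gt x (X m M b T c) with k | k
  · exact ⟨T, c, T0, le_rfl, sT, k, Or.inr rfl⟩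
  · have hcont : ContinuousOn (fun t => X m M b t (s * exp (-(m * t)))) (Icc 0 T) :=
      fun v _ => (hv h s v).continuousAt.continuousWithinAt
    have cT : s * exp (-(m * T)) = c := by rw [sT, mul_assoc, ← exp_add]; simp
    obtain ⟨t, ht, e⟩ := intermediate_value_Icc' T0 hcont
      (show x ∈ _ from ⟨by simp only [cT]; exact k.le, by simpa using hx⟩)
    refine ⟨t, s * exp (-(m * t)), ht.1, ?_, ?_, e.symm.le, Or.inl e.symm⟩
    · rw [← cT]
      have : exp (-(m * T)) ≤ exp (-(m * t)) := exp_le_exp.2 (by nlinarith [ht.2])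
      have := hc.trans hs
      gcongr
    · rw [mul_assoc, ← exp_add]; simp

def Good (L : ℝ) (F g : ℝ → ℝ) (I : Set ℝ) : Prop :=
  ∀ s ∈ I, ∀ s' ∈ I, s < s' → P L s (F s) (g s) s' (F s') (g s')

lemma Good.deriv {L : ℝ} {F g : ℝ → ℝ} {I : Set ℝ} (h : Good L F g I) {x : ℝ} (hx : x ∈ I) :
    HasDerivWithinAt F (g x) I x := by
  have key : ∀ y ∈ I, |F y - F x - (y - x) * g x| ≤ |L| * |y - x| * |y - x| := by
    intro y hy
    rcases lt_trichotomy x y with k | k | k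
    · obtain ⟨a1, a2, a3, a4, a5⟩ := h x hx y hy k
      have k' := sub_pos.2 k
      rw [abs_of_pos k', abs_le]
      have := mul_le_mul_of_nonneg_right (le_abs_self L) k'.le
      have h1 : (g y - g x) * (y - x) ≤ |L| * (y - x) * (y - x) := by gcongr; linarith
      have h2 : 0 ≤ (g y - g x) * (y - x) := mul_nonneg (by linarith) k'.le
      constructor <;> nlinarith
    · subst k; simp
    · obtain ⟨a1, a2, a3, a4, a5⟩ := h y hy x hx k
      have k' := sub_pos.2 k
      rw [abs_sub_comm y x, abs_of_pos k', abs_le]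
      have := mul_le_mul_of_nonneg_right (le_abs_self L) k'.le
      have h1 : (g x - g y) * (x - y) ≤ |L| * (x - y) * (x - y) := by gcongr; linarith
      have h2 : 0 ≤ (g x - g y) * (x - y) := mul_nonneg (by linarith) k'.le
      constructor <;> nlinarith
  rw [hasDerivWithinAt_iff_isLittleO, Asymptotics.isLittleO_iff]
  intro e he
  have hL : 0 < |L| + 1 := by positivity
  have hball : Metric.ball x (e / (|L| + 1)) ∈ nhdsWithin x I :=
    mem_nhdsWithin_of_mem_nhds (Metric.ball_mem_nhds x (by positivity))
  filter_upwards [hball, self_mem_nhdsWithin] with y hy hyI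
  have k := key y hyI
  rw [Metric.mem_ball, Real.dist_eq, lt_div_iff₀ hL] at hy
  simp only [smul_eq_mul, Real.norm_eq_abs]
  refine k.trans ?_
  have := abs_nonneg (y - x)
  gcongr
  nlinarith

lemma Good.le {L : ℝ} {F g : ℝ → ℝ} {I : Set ℝ} (h : Good L F g I) {s s' : ℝ} (hs : s ∈ I)
    (hs' : s' ∈ I) (k : s ≤ s') : g s ≤ g s' ∧ g s' - g s ≤ L * (s' - s) := by
  rcases k.eq_or_lt with k | k
  · subst k; simp
  · exact ⟨(h s hs s' hs' k).2.1, (h s hs s' hs' k).2.2.1⟩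

lemma mono_deriv {g : ℝ → ℝ} {I : Set ℝ} (hI : UniqueDiffOn ℝ I) (hg : MonotoneOn g I) {x d : ℝ}
    (hx : x ∈ I) (hd : HasDerivWithinAt g d I x) : 0 ≤ d := by
  rw [← hd.derivWithin (hI x hx)]
  exact hg.derivWithin_nonneg

lemma Good.bounds {L : ℝ} {F g : ℝ → ℝ} {I : Set ℝ} (h : Good L F g I) (hI : UniqueDiffOn ℝ I)
    {x d : ℝ} (hx : x ∈ I) (hd : HasDerivWithinAt g d I x) : 0 ≤ d ∧ d ≤ L := by
  refine ⟨mono_deriv hI (fun s hs s' hs' k => (h.le hs hs' k).1) hx hd, ?_⟩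
  have h2 : HasDerivWithinAt (fun s => L * s - g s) (L - d) I x := by
    have := ((hasDerivWithinAt_id x I).const_mul L).sub hd
    exact HasDerivWithinAt.congr_deriv this (by simp)
  have := mono_deriv hI (fun s hs s' hs' k => by
    have := (h.le hs hs' k).2
    linarith) hx h2
  linarith

lemma Good.ac {L : ℝ} {F g : ℝ → ℝ} {I : Set ℝ} (h : Good L F g I) {l r : ℝ}
    (hI : Icc l r ⊆ I) : AbsolutelyContinuousOnIcc g l r := by
  intro ε hε
  have hL : 0 < |L| + 1 := by positivity
  refine ⟨ε / (|L| + 1), by positivity, ?_⟩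
  intro k a b hab _ hsum
  rw [lt_div_iff₀ hL] at hsum
  refine lt_of_le_of_lt ?_ hsum
  rw [Finset.sum_mul]
  refine Finset.sum_le_sum fun i _ => ?_
  obtain ⟨h1, h2, h3⟩ := hab i
  have := h.le (hI ⟨h1, h2.trans h3⟩) (hI ⟨h1.trans h2, h3⟩) h2
  rw [abs_of_nonneg (by linarith)]
  nlinarith [le_abs_self L]

theorem core (h : Par m M b c) : ∃ f f1 f2 : ℝ × ℝ → ℝ,
    (∀ x₂, 0 ≤ x₂ → Good (L1 m M b c) (fun s => f (s, x₂)) (fun s => f1 (s, x₂)) (Iic 0)) ∧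
    (∀ x₁, x₁ ≤ 0 → Good (L2 m M b c) (fun s => f (x₁, s)) (fun s => f2 (x₁, s)) (Ici 0)) ∧
    (∀ x₁, x₁ ≤ 0 → MonotoneOn (fun s => f1 (x₁, s)) (Ici 0)) ∧
    (∀ x₁ x₂, x₂ ≤ c → f1 (x₁, x₂) = 0 ∧ f2 (x₁, x₂) = 0) ∧
    (∀ x₁ x₂, x₁ ≤ 0 → 0 ≤ f1 (x₁, x₂)) ∧
    (∀ x₂, f1 (0, x₂) = 1 / b * max (x₂ - c) 0 ∧ f2 (0, x₂) = 1 / b * max (x₂ - c) 0) ∧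
    (∀ x₁ x₂, x₁ ≤ 0 → (-b - M * x₁ + m * x₂) * f1 (x₁, x₂) - m * x₂ * f2 (x₁, x₂)
      = -max (x₂ - c) 0) := by
  have ex : ∀ x : ℝ × ℝ, ∃ z : ℝ × ℝ, x.1 ≤ 0 → c < x.2 → Rel m M b c x.1 x.2 z.1 z.2 := by
    intro x
    by_cases k : x.1 ≤ 0 ∧ c < x.2
    · obtain ⟨t, y, r⟩ := exists_rel h k.1 k.2
      exact ⟨(t, y), fun _ _ => r⟩
    · exact ⟨0, fun k1 k2 => absurd ⟨k1, k2⟩ k⟩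
  choose z hz using ex
  have hz' : ∀ {x s : ℝ}, x ≤ 0 → ¬ s ≤ c → Rel m M b c x s (z (x, s)).1 (z (x, s)).2 :=
    fun hx hs => hz (_, _) hx (not_le.1 hs)
  have hb := h.hb; have hc := h.c0; have hm := h.m0; have hM := h.hM
  have k0 : 0 < m * c - b := sub_pos.2 h.hc
  have L10 : 0 ≤ L1 m M b c := by unfold L1; positivity
  have L20 : 0 ≤ L2 m M b c := le_trans (by positivity) (L2_ge h).2
  have relc : ∀ {x : ℝ}, x ≤ 0 → Rel m M b c x c 0 c := fun hx =>
    ⟨le_rfl, le_rfl, by simp, by simpa using hx, Or.inr rfl⟩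
  refine ⟨fun x => if x.2 ≤ c then 0 else G m b c (z x).1 (z x).2,
    fun x => if x.2 ≤ c then 0 else phi1 M b c (z x).1 (z x).2,
    fun x => if x.2 ≤ c then 0 else phi2 m M b c (z x).1 (z x).2, ?_, ?_, ?_, ?_, ?_, ?_, ?_⟩
  · intro x₂ _ s hs s' hs' hss
    by_cases k : x₂ ≤ c
    · simp only [k, if_true]
      refine ⟨hss.le, le_rfl, ?_, ?_, ?_⟩ <;> simp
      have := sub_pos.2 hss; positivity
    · simp only [k, if_false]
      exact slice1 h (hz' hs k) (hz' hs' k) hss.le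
  · intro x hx s _ s' _ hss
    have zP : ∀ {s s' : ℝ}, s ≤ s' → P (L2 m M b c) s 0 0 s' 0 0 := by
      intro s s' hss
      refine ⟨hss, le_rfl, ?_, ?_, ?_⟩ <;> simp
      have := sub_nonneg.2 hss; positivity
    by_cases k' : s' ≤ c
    · have k : s ≤ c := hss.le.trans k'
      simp only [k, k', if_true]
      exact zP hss.le
    · by_cases k : s ≤ c
      · simp only [k, k', if_true, if_false]
        refine (zP k).trans ?_
        have := slice2 h hx (relc hx) (hz' hx k') (not_le.1 k')
        simpa [G, phi2] using this
      · simp only [k, k', if_false]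
        exact slice2 h hx (hz' hx k) (hz' hx k') hss
  · intro x hx s _ s' _ hss
    rcases hss.eq_or_lt with hss | hss
    · subst hss; exact le_rfl
    simp only
    by_cases k' : s' ≤ c
    · have k : s ≤ c := hss.le.trans k'
      simp [k, k']
    · by_cases k : s ≤ c
      · simp only [k, k', if_true, if_false]
        exact phi1_nonneg h (hz' hx k').hy
      · simp only [k, k', if_false]
        exact slice12 h hx (hz' hx k) (hz' hx k') hss
  · intro x s hs; simp [hs]
  · intro x s hx
    by_cases k : s ≤ c
    · simp [k]
    · simp only [k, if_false]
      exact phi1_nonneg h (hz' hx k).hy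
  · intro s
    by_cases k : s ≤ c
    · simp [k]
    · simp only [k, if_false]
      obtain ⟨e1, e2⟩ := (hz' le_rfl k).t_zero h
      rw [e1, e2, max_eq_left (by linarith)]
      constructor
      · simp [phi1]; ring
      · simp [phi2, R]; ring
  · intro x s hx
    by_cases k : s ≤ c
    · simp [k]
    · simp only [k, if_false]
      rw [max_eq_left (by linarith)]
      exact pde h (hz' hx k)

end Lyap

/-- Lemma 9 of the paper: existence of the Lyapunov function `f*` solving the
PDE `L f* = -(x₂ - κ/√n)_+` on `Ω = (-∞,0] × [0,∞)` with the stated boundary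
conditions, sign conditions and second-derivative bounds.  Here `f1` and `f2`
are the first-order partial derivatives of `f` (one-sided at the boundary),
and second-order derivatives are quantified at every point where they exist. -/
theorem lyapunov_function_exists
    (μ₁ μM β : ℝ) (h1 : μM < μ₁) (h2 : 0 < μM) (hβ : 0 < β)
    (n : ℕ) (hn : 0 < n) (κ : ℝ) (hκ : β / μ₁ < κ) :
    ∃ f f1 f2 : ℝ × ℝ → ℝ,
      -- the first-order partial derivatives exist at every point of Ω
      (∀ x₁ x₂ : ℝ, x₁ ≤ 0 → 0 ≤ x₂ →
        HasDerivWithinAt (fun s => f (s, x₂)) (f1 (x₁, x₂)) (Set.Iic 0) x₁ ∧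
        HasDerivWithinAt (fun s => f (x₁, s)) (f2 (x₁, x₂)) (Set.Ici 0) x₂) ∧
      -- `f1(·, x₂)` is (locally) absolutely continuous in the first variable
      (∀ x₂ : ℝ, 0 ≤ x₂ → ∀ a b : ℝ, a ≤ b → b ≤ 0 →
        AbsolutelyContinuousOnIcc (fun s => f1 (s, x₂)) a b) ∧
      -- `f2(x₁, ·)` is (locally) absolutely continuous in the second variable
      (∀ x₁ : ℝ, x₁ ≤ 0 → ∀ a b : ℝ, 0 ≤ a → a ≤ b →
        AbsolutelyContinuousOnIcc (fun s => f2 (x₁, s)) a b) ∧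
      -- (a) the PDE
      (∀ x₁ x₂ : ℝ, x₁ ≤ 0 → 0 ≤ x₂ →
        (-β / Real.sqrt (n : ℝ) - μM * x₁ + μ₁ * x₂) * f1 (x₁, x₂) -
            μ₁ * x₂ * f2 (x₁, x₂)
          = -max (x₂ - κ / Real.sqrt (n : ℝ)) 0) ∧
      -- (b) the boundary condition
      (∀ x₂ : ℝ, 0 ≤ x₂ →
        f1 (0, x₂) = Real.sqrt (n : ℝ) / β * max (x₂ - κ / Real.sqrt (n : ℝ)) 0 ∧
        f2 (0, x₂) = Real.sqrt (n : ℝ) / β * max (x₂ - κ / Real.sqrt (n : ℝ)) 0) ∧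
      -- (c) `f1 ≥ 0` on Ω
      (∀ x₁ x₂ : ℝ, x₁ ≤ 0 → 0 ≤ x₂ → 0 ≤ f1 (x₁, x₂)) ∧
      -- (c,d,e) the second derivative `f11`, wherever it exists, is nonnegative,
      -- vanishes for `x₂ ≤ κ/√n`, and is bounded by `C₅(κ)·√n`
      (∀ x₁ x₂ : ℝ, x₁ ≤ 0 → 0 ≤ x₂ → ∀ d : ℝ,
        HasDerivWithinAt (fun s => f1 (s, x₂)) d (Set.Iic 0) x₁ →
          0 ≤ d ∧
          d ≤ (1 / β * ((μ₁ + μM) / μ₁) * (κ / (κ - β / μ₁))) * Real.sqrt (n : ℝ) ∧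
          (x₂ ≤ κ / Real.sqrt (n : ℝ) → d = 0)) ∧
      -- (c) the mixed second derivative `f12`, wherever it exists, is nonnegative
      (∀ x₁ x₂ : ℝ, x₁ ≤ 0 → 0 ≤ x₂ → ∀ d : ℝ,
        HasDerivWithinAt (fun s => f1 (x₁, s)) d (Set.Ici 0) x₂ → 0 ≤ d) ∧
      -- (c,d,e) the second derivative `f22`, wherever it exists, is nonnegative,
      -- vanishes for `x₂ ≤ κ/√n`, and is bounded by `C₆(κ)·√n`
      (∀ x₁ x₂ : ℝ, x₁ ≤ 0 → 0 ≤ x₂ → ∀ d : ℝ,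
        HasDerivWithinAt (fun s => f2 (x₁, s)) d (Set.Ici 0) x₂ →
          0 ≤ d ∧
          d ≤ (1 / (μ₁ * κ) + 1 / β * (μ₁ / (μ₁ - μM)) ^ 2 * (κ / (κ - β / μ₁)) +
                1 / β * (μ₁ * (1 + μM) / (μ₁ - μM))) * Real.sqrt (n : ℝ) ∧
          (x₂ ≤ κ / Real.sqrt (n : ℝ) → d = 0)) := by
  have hs : 0 < Real.sqrt (n : ℝ) := Real.sqrt_pos.2 (by exact_mod_cast hn)
  have hm : 0 < μ₁ := h2.trans h1
  have hd : 0 < μ₁ - μM := sub_pos.2 h1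
  have hk : β < μ₁ * κ := by rw [div_lt_iff₀ hm] at hκ; linarith
  have hκ0 : 0 < κ := lt_trans (by positivity) hκ
  set q := Real.sqrt (n : ℝ) with hq
  have par : Lyap.Par μ₁ μM (β / q) (κ / q) :=
    ⟨h2, h1, by positivity, by rw [mul_div_assoc']; gcongr⟩
  have hkk : 0 < μ₁ * κ - β := sub_pos.2 hk
  have hkd : κ - β / μ₁ = (μ₁ * κ - β) / μ₁ := by field_simp
  have hqd : μ₁ * (κ / q) - β / q = (μ₁ * κ - β) / q := by field_simp
  have hL1 : Lyap.L1 μ₁ μM (β / q) (κ / q) =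
      (1 / β * ((μ₁ + μM) / μ₁) * (κ / (κ - β / μ₁))) * q := by
    unfold Lyap.L1
    rw [hkd, hqd]; field_simp
  have hL2 : Lyap.L2 μ₁ μM (β / q) (κ / q) ≤
      (1 / (μ₁ * κ) + 1 / β * (μ₁ / (μ₁ - μM)) ^ 2 * (κ / (κ - β / μ₁)) +
                1 / β * (μ₁ * (1 + μM) / (μ₁ - μM))) * q := by
    have e : (1 / (μ₁ * κ) + 1 / β * (μ₁ / (μ₁ - μM)) ^ 2 * (κ / (κ - β / μ₁)) +
                1 / β * (μ₁ * (1 + μM) / (μ₁ - μM))) * q =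
        Lyap.L2 μ₁ μM (β / q) (κ / q) + 1 / β * (μ₁ * μM / (μ₁ - μM)) * q := by
      unfold Lyap.L2
      rw [hkd, hqd]; field_simp; ring
    rw [e]
    have : 0 ≤ 1 / β * (μ₁ * μM / (μ₁ - μM)) * q := by positivity
    linarith
  obtain ⟨f, f1, f2, g1, g2, g3, g4, g5, g6, g7⟩ := Lyap.core par
  have hc0 : 0 < κ / q := by positivity
  refine ⟨f, f1, f2, ?_, ?_, ?_, ?_, ?_, ?_, ?_, ?_, ?_⟩
  · intro x₁ x₂ hx₁ hx₂
    exact ⟨(g1 x₂ hx₂).deriv hx₁, (g2 x₁ hx₁).deriv hx₂⟩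
  · intro x₂ hx₂ a b _ hb0
    exact (g1 x₂ hx₂).ac (fun s hs => hs.2.trans hb0)
  · intro x₁ hx₁ a b ha _
    exact (g2 x₁ hx₁).ac (fun s hs => ha.trans hs.1)
  · intro x₁ x₂ hx₁ _
    rw [neg_div]
    exact g7 x₁ x₂ hx₁
  · intro x₂ _
    have := g6 x₂
    rwa [one_div_div] at this
  · intro x₁ x₂ hx₁ _
    exact g5 x₁ x₂ hx₁
  · intro x₁ x₂ hx₁ hx₂ d hdd
    obtain ⟨b1, b2⟩ := (g1 x₂ hx₂).bounds (uniqueDiffOn_Iic 0) hx₁ hdd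
    refine ⟨b1, hL1 ▸ b2, fun hle => ?_⟩
    have e : (fun s => f1 (s, x₂)) = fun _ => (0 : ℝ) := funext fun s => (g4 s x₂ hle).1
    rw [e] at hdd
    exact (uniqueDiffOn_Iic (0 : ℝ) x₁ hx₁).eq_deriv _ hdd (hasDerivWithinAt_const x₁ _ 0)
  · intro x₁ x₂ hx₁ hx₂ d hdd
    exact Lyap.mono_deriv (uniqueDiffOn_Ici 0) (g3 x₁ hx₁) hx₂ hdd
  · intro x₁ x₂ hx₁ hx₂ d hdd
    obtain ⟨b1, b2⟩ := (g2 x₁ hx₁).bounds (uniqueDiffOn_Ici 0) hx₂ hdd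
    refine ⟨b1, b2.trans hL2, fun hle => ?_⟩
    have hmem : x₂ ∈ Set.Icc 0 (κ / q) := ⟨hx₂, hle⟩
    have h3 : HasDerivWithinAt (fun s => f2 (x₁, s)) d (Set.Icc 0 (κ / q)) x₂ :=
      hdd.mono (fun s hs => hs.1)
    have h4 : HasDerivWithinAt (fun s => f2 (x₁, s)) 0 (Set.Icc 0 (κ / q)) x₂ :=
      (hasDerivWithinAt_const x₂ _ (0 : ℝ)).congr (fun s hs => (g4 x₁ s hs.2).2)
        (g4 x₁ x₂ hle).2
    exact (uniqueDiffOn_Icc hc0 x₂ hmem).eq_deriv _ h3 h4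
end
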